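/- arXiv:1508.00211 — 7 statements merged into one kernel-verified Lean document; each statement's English description precedes it below -/
import Mathlib

section
/- Let k be an algebraically closed field and V a nonzero finite-dimensional vector space over k. Let T : V → V be a k-linear map, and suppose V = V_1 ⊕ V_2 ⊕ ... ⊕ V_r is a direct sum decomposition such that T(V_i) = V_{i+1} for all i (indices taken modulo r). If α ∈ k is an eigenvalue of T, then ζα is also an eigenvalue of T for every ζ ∈ k satisfying ζ^r = 1. -/
/-- Two families with components in independent submodules and equal sums agree. -/
theorem iSupIndep.eq_of_sum_eq {ι R M : Type*} [Fintype ι] [Ring R] [AddCommGroup M]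
    [Module R M] {W : ι → Submodule R M} (hW : iSupIndep W) {f g : ι → M}
    (hf : ∀ i, f i ∈ W i) (hg : ∀ i, g i ∈ W i) (h : ∑ i, f i = ∑ i, g i) (i : ι) :
    f i = g i := by
  classical
  have hinj := hW.dfinsupp_lsum_injective
  have key : (DFinsupp.equivFunOnFintype.symm fun i => (⟨f i, hf i⟩ : W i)) =
      DFinsupp.equivFunOnFintype.symm fun i => (⟨g i, hg i⟩ : W i) := by
    apply hinj
    simpa [DFinsupp.lsum_apply_apply, DFinsupp.sumAddHom_apply,
      DFinsupp.sum_eq_sum_fintype, DFinsupp.equivFunOnFintype] using h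
  simpa using congrArg Subtype.val (congrFun (DFinsupp.equivFunOnFintype.symm.injective key) i)

/-- The powers of an `r`-th root of unity are well defined on `Fin r`. -/
theorem pow_val_add_one_of_pow_eq_one {M : Type*} [Monoid M] {r : ℕ} [NeZero r] {ξ : M}
    (hξ : ξ ^ r = 1) (i : Fin r) : ξ ^ (i + 1).val = ξ ^ i.val * ξ := by
  rw [Fin.val_add, ← pow_eq_pow_mod _ hξ, pow_add, Fin.val_one', ← pow_eq_pow_mod _ hξ, pow_one]


/-- Let `k` be an algebraically closed field and `V` a nonzero finite-dimensional
`k`-vector space. Let `T : V → V` be `k`-linear, and suppose `V = ⊕_{i=1}^r V_i`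
with `T(V_i) = V_{i+1}` (indices mod `r`). If `α` is an eigenvalue of `T`, then
`ζ * α` is an eigenvalue of `T` for every `ζ` with `ζ ^ r = 1`. -/
theorem stmt_0 {k V : Type*} [Field k] [IsAlgClosed k] [AddCommGroup V] [Module k V]
    [FiniteDimensional k V] [Nontrivial V] (T : V →ₗ[k] V) (r : ℕ) [NeZero r]
    (W : Fin r → Submodule k V) (hW : DirectSum.IsInternal W)
    (hT : ∀ i : Fin r, (W i).map T = W (i + 1))
    (α : k) (hα : Module.End.HasEigenvalue T α)
    (ζ : k) (hζ : ζ ^ r = 1) :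
    Module.End.HasEigenvalue T (ζ * α) := by
  classical
  have hζ0 : ζ ≠ 0 := by
    rintro rfl
    simp [zero_pow (NeZero.ne r)] at hζ
  obtain ⟨v, hv⟩ := hα.exists_hasEigenvector
  obtain ⟨x, hx⟩ := hW.surjective v
  have hsum : ∑ i, (x i : V) = v := by
    rw [← hx, DirectSum.coeAddMonoidHom_eq_dfinsuppSum, DFinsupp.sum_eq_sum_fintype _ (by simp)]
    rfl
  have hmem (i : Fin r) : T (x i) ∈ W (i + 1) := hT i ▸ Submodule.mem_map_of_mem (x i).2
  have hshift (i : Fin r) : T (x i) = α • (x (i + 1) : V) := by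
    have h := hW.submodule_iSupIndep.eq_of_sum_eq
      (f := fun j => T (x (j - 1))) (g := fun j => α • (x j : V))
      (fun j => by simpa using hmem (j - 1)) (fun j => (W j).smul_mem α (x j).2)
      (by
        rw [← Finset.smul_sum, hsum, ← hv.apply_eq_smul, ← hsum, map_sum]
        exact Equiv.sum_comp (Equiv.subRight (1 : Fin r)) fun j => T (x j)) (i + 1)
    rwa [add_sub_cancel_right] at h
  have hξ : ζ⁻¹ ^ r = 1 := by rw [inv_pow, hζ, inv_one]
  let y : Fin r → V := fun i => ζ⁻¹ ^ i.val • (x i : V)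
  have hTy (i : Fin r) : T (y i) = (ζ * α) • y (i + 1) := by
    simp only [y, map_smul, hshift, smul_smul, pow_val_add_one_of_pow_eq_one hξ]
    congr 1
    field_simp
  refine Module.End.hasEigenvalue_of_hasEigenvector (x := ∑ i, y i) ⟨?_, fun h0 => hv.2 ?_⟩
  · rw [Module.End.mem_eigenspace_iff, map_sum, Finset.smul_sum]
    simp only [hTy]
    exact Equiv.sum_comp (Equiv.addRight (1 : Fin r)) fun j => (ζ * α) • y j
  · have hy := hW.submodule_iSupIndep.eq_of_sum_eq (f := y) (g := 0)
      (fun i => (W i).smul_mem _ (x i).2) (fun i => (W i).zero_mem) (by simpa using h0)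
    rw [← hsum]
    refine Finset.sum_eq_zero fun i _ => ?_
    exact (smul_eq_zero_iff_right (pow_ne_zero _ (inv_ne_zero hζ0))).1 (hy i)
end

section
/- Let ℓ be an odd prime, V a 6-dimensional vector space over F_ℓ with a nondegenerate alternating bilinear form ⟨·,·⟩, G a group, and ρ : G → GL(V) a representation acting by symplectic similitudes with multiplier character χ : G → F_ℓ^×. Suppose that no Jordan–Hölder factor of the G-module V is 1-dimensional, but that V has a G-invariant irreducible subspace U of dimension 2 or 4. Then V has a 2-dimensional Jordan–Hölder factor W whose determinant character (the character g ↦ det of the action of g on W) equals χ. -/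
open Module

/-- A subspace stable under all the operators of a representation. -/
def RepInvariant {F V G : Type*} [Field F] [AddCommGroup V] [Module F V] [Group G]
    (ρ : Representation F G V) (W : Submodule F V) : Prop :=
  ∀ g : G, ∀ v ∈ W, ρ g v ∈ W

/-- A subspace `U` is an irreducible (simple) subrepresentation: it is nonzero and its
only invariant subspaces are `⊥` and `U` itself. -/
def RepIrreducible {F V G : Type*} [Field F] [AddCommGroup V] [Module F V] [Group G]
    (ρ : Representation F G V) (U : Submodule F V) : Prop :=
  U ≠ ⊥ ∧ ∀ U' : Submodule F V, U' ≤ U → RepInvariant ρ U' → U' = ⊥ ∨ U' = U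

/-- The linear endomorphism induced by `ρ g` on the subquotient `W₂ / (W₁ ∩ W₂)`
of two invariant subspaces `W₁ ≤ W₂`. -/
def repFactorMap {F V G : Type*} [Field F] [AddCommGroup V] [Module F V] [Group G]
    (ρ : Representation F G V) (W₁ W₂ : Submodule F V)
    (h1 : RepInvariant ρ W₁) (h2 : RepInvariant ρ W₂) (g : G) :
    (W₂ ⧸ W₁.comap W₂.subtype) →ₗ[F] (W₂ ⧸ W₁.comap W₂.subtype) :=
  Submodule.mapQ _ _ ((ρ g).restrict (fun x hx => h2 g x hx))
    (fun x hx => by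
      simp only [Submodule.mem_comap, LinearMap.restrict_apply, Submodule.coe_subtype] at hx ⊢
      exact h1 g (x : V) hx)

theorem RepInvariant.inf {F V G : Type*} [Field F] [AddCommGroup V] [Module F V] [Group G]
    {ρ : Representation F G V} {W W' : Submodule F V} (h : RepInvariant ρ W)
    (h' : RepInvariant ρ W') : RepInvariant ρ (W ⊓ W') :=
  fun g v hv => ⟨h g v hv.1, h' g v hv.2⟩

/-- The orthogonal of an invariant subspace under a group of similitudes is invariant. -/
theorem RepInvariant.orthogonal {F V G : Type*} [Field F] [AddCommGroup V] [Module F V] [Group G]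
    {ρ : Representation F G V} {B : LinearMap.BilinForm F V} {χ : G → F}
    (hsim : ∀ (g : G) (v w : V), B (ρ g v) (ρ g w) = χ g * B v w)
    {W : Submodule F V} (h : RepInvariant ρ W) : RepInvariant ρ (B.orthogonal W) := by
  intro g v hv
  rw [LinearMap.BilinForm.mem_orthogonal_iff] at hv ⊢
  intro n hn
  have hg := hsim g (ρ g⁻¹ n) v
  rwa [Representation.self_inv_apply, hv _ (h g⁻¹ n hn), mul_zero] at hg

theorem finrank_subquotient_add_finrank {F V : Type*} [Field F] [AddCommGroup V] [Module F V]
    [FiniteDimensional F V] {W₁ W₂ : Submodule F V} (h : W₁ ≤ W₂) :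
    finrank F (W₂ ⧸ W₁.comap W₂.subtype) + finrank F W₁ = finrank F W₂ := by
  rw [← (Submodule.comapSubtypeEquivOfLe h).finrank_eq]
  exact Submodule.finrank_quotient_add_finrank _

/-- If no subquotient of `V` is one-dimensional, every two-dimensional subquotient is simple. -/
theorem eq_bot_or_eq_top_of_finrank_subquotient_eq_two {F V G : Type*} [Field F] [AddCommGroup V]
    [Module F V] [FiniteDimensional F V] [Group G] {ρ : Representation F G V}
    (hno1 : ¬ ∃ (W₁ W₂ : Submodule F V) (_ : W₁ ≤ W₂)
      (_ : RepInvariant ρ W₁) (_ : RepInvariant ρ W₂),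
        finrank F (W₂ ⧸ W₁.comap W₂.subtype) = 1)
    {W₁ W₂ : Submodule F V} (h1 : RepInvariant ρ W₁) (h2 : RepInvariant ρ W₂)
    (hfin : finrank F (W₂ ⧸ W₁.comap W₂.subtype) = 2)
    (X : Submodule F (W₂ ⧸ W₁.comap W₂.subtype))
    (hX : ∀ g : G, ∀ x ∈ X, repFactorMap ρ W₁ W₂ h1 h2 g x ∈ X) : X = ⊥ ∨ X = ⊤ := by
  by_contra! hne
  have hpos : finrank F X ≠ 0 := fun h => hne.1 (Submodule.finrank_eq_zero.mp h)
  have hlt := Submodule.finrank_lt hne.2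
  have hquot := X.finrank_quotient_add_finrank
  set Y : Submodule F W₂ := X.comap (Submodule.mkQ _) with hY
  have hle : W₁.comap W₂.subtype ≤ Y := by
    intro x hx
    have hx0 : (W₁.comap W₂.subtype).mkQ x = 0 := by simpa using hx
    simp [hY, hx0]
  have hmap : Y.map (Submodule.mkQ _) = X :=
    Submodule.map_comap_eq_of_surjective (Submodule.mkQ_surjective _) X
  have hcomap : (Y.map W₂.subtype).comap W₂.subtype = Y :=
    Submodule.comap_map_eq_of_injective W₂.subtype_injective Y
  refine hno1 ⟨Y.map W₂.subtype, W₂, Submodule.map_subtype_le _ _, ?_, h2, ?_⟩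
  · rintro g _ ⟨y, hy, rfl⟩
    exact ⟨⟨ρ g y, h2 g y y.2⟩, hX g _ hy, rfl⟩
  · rw [hcomap, ← (Submodule.quotientQuotientEquivQuotient _ Y hle).finrank_eq, hmap]
    omega

/-- On a two-dimensional subquotient `W₂ / W₁` such that `W₁` is orthogonal to `W₂` and the
alternating form does not vanish on `W₂`, a similitude acts with determinant its multiplier. -/
theorem det_repFactorMap_eq_multiplier {F V G : Type*} [Field F] [AddCommGroup V] [Module F V]
    [Group G] {ρ : Representation F G V} {B : LinearMap.BilinForm F V}
    (halt : B.IsAlt) {χ : G → F}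
    (hsim : ∀ (g : G) (v w : V), B (ρ g v) (ρ g w) = χ g * B v w)
    {W₁ W₂ : Submodule F V} (h1 : RepInvariant ρ W₁) (h2 : RepInvariant ρ W₂)
    (hfin : finrank F (W₂ ⧸ W₁.comap W₂.subtype) = 2)
    (horth : W₁ ≤ B.orthogonal W₂) {v w : V} (hv : v ∈ W₂) (hw : w ∈ W₂) (hvw : B v w ≠ 0)
    (g : G) : LinearMap.det (repFactorMap ρ W₁ W₂ h1 h2 g) = χ g := by
  have hr : ∀ n ∈ W₂, ∀ r ∈ W₁, B n r = 0 := fun n hn r hrr => horth hrr n hn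
  have hl : ∀ r ∈ W₁, ∀ n ∈ W₂, B r n = 0 := fun r hrr n hn => halt.isRefl _ _ (hr n hn r hrr)
  have hwv : B w v = -B v w := (LinearMap.IsAlt.neg halt v w).symm
  let π := (W₁.comap W₂.subtype).mkQ
  have hπ : ∀ z : W₂, π z = 0 ↔ (z : V) ∈ W₁ := by simp [π]
  let v' : W₂ := ⟨v, hv⟩
  let w' : W₂ := ⟨w, hw⟩
  have hli : LinearIndependent F ![π v', π w'] := by
    rw [LinearIndependent.pair_iff]
    intro s t hst
    rw [← map_smul, ← map_smul, ← map_add, hπ] at hst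
    have ev := hr v hv _ hst
    have ew := hr w hw _ hst
    simp only [v', w', Submodule.coe_add, Submodule.coe_smul, map_add, map_smul, halt v, halt w,
      smul_eq_mul, mul_zero, zero_add, add_zero, hwv, mul_neg, neg_eq_zero, mul_eq_zero, hvw,
      or_false] at ev ew
    exact ⟨ew, ev⟩
  let b := basisOfLinearIndependentOfCardEqFinrank hli (by simp [hfin])
  have hb0 : b 0 = π v' := by simp [b]
  have hb1 : b 1 = π w' := by simp [b]
  let f := repFactorMap ρ W₁ W₂ h1 h2 g
  have hexp : ∀ z : W₂, ∃ r ∈ W₁,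
      ρ g z = b.repr (f (π z)) 0 • v + b.repr (f (π z)) 1 • w + r := by
    intro z
    refine ⟨ρ g z - (b.repr (f (π z)) 0 • v + b.repr (f (π z)) 1 • w), ?_, by abel⟩
    have hsum := b.sum_repr (f (π z))
    rw [Fin.sum_univ_two, hb0, hb1] at hsum
    have hz : π (⟨ρ g z, h2 g z z.2⟩ -
        (b.repr (f (π z)) 0 • v' + b.repr (f (π z)) 1 • w')) = 0 := by
      rw [map_sub, map_add, map_smul, map_smul, hsum, sub_eq_zero]
      rfl
    exact (hπ _).mp hz
  obtain ⟨r, hrr, hgv⟩ := hexp v'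
  obtain ⟨s, hss, hgw⟩ := hexp w'
  have key := hsim g v w
  rw [show ρ g v = _ from hgv, show ρ g w = _ from hgw] at key
  have hrs : B r s = 0 := hl r hrr s <| by
    have hs := h2 g w hw
    rw [show ρ g w = _ from hgw] at hs
    exact (Submodule.add_mem_iff_right _
      (W₂.add_mem (W₂.smul_mem _ hv) (W₂.smul_mem _ hw))).mp hs
  simp only [map_add, map_smul, LinearMap.add_apply, LinearMap.smul_apply, halt v, halt w,
    smul_eq_mul, hwv, hrs, hr v hv s hss, hr w hw s hss, hl r hrr v hv, hl r hrr w hw] at key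
  rw [← LinearMap.det_toMatrix b, Matrix.det_fin_two]
  simp only [LinearMap.toMatrix_apply, hb0, hb1]
  apply mul_right_cancel₀ hvw
  linear_combination key

/-- Lemma 3.4 of Anni–Lemos–Siksek: if no Jordan–Hölder factor of the `G`-module `V`
(`V` six-dimensional symplectic, `G` acting by symplectic similitudes with multiplier `χ`)
is `1`-dimensional, but `V` has an irreducible invariant subspace of dimension `2` or `4`,
then `V` has a `2`-dimensional Jordan–Hölder factor whose determinant character is `χ`. -/
theorem stmt_5 (ℓ : ℕ) [Fact ℓ.Prime] (hℓ2 : ℓ ≠ 2)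
    {V : Type*} [AddCommGroup V] [Module (ZMod ℓ) V] [FiniteDimensional (ZMod ℓ) V]
    (hdim : finrank (ZMod ℓ) V = 6)
    (B : LinearMap.BilinForm (ZMod ℓ) V)
    (halt : ∀ v : V, B v v = 0) (hnd : B.Nondegenerate)
    {G : Type*} [Group G] (ρ : Representation (ZMod ℓ) G V) (χ : G →* (ZMod ℓ)ˣ)
    (hsim : ∀ (g : G) (v w : V), B (ρ g v) (ρ g w) = (χ g : ZMod ℓ) * B v w)
    (hno1 : ¬ ∃ (W₁ W₂ : Submodule (ZMod ℓ) V) (_ : W₁ ≤ W₂)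
      (_ : RepInvariant ρ W₁) (_ : RepInvariant ρ W₂),
        finrank (ZMod ℓ) (W₂ ⧸ W₁.comap W₂.subtype) = 1)
    (hU : ∃ U : Submodule (ZMod ℓ) V, RepInvariant ρ U ∧ RepIrreducible ρ U ∧
      (finrank (ZMod ℓ) U = 2 ∨ finrank (ZMod ℓ) U = 4)) :
    ∃ (W₁ W₂ : Submodule (ZMod ℓ) V) (h12 : W₁ ≤ W₂)
      (h1 : RepInvariant ρ W₁) (h2 : RepInvariant ρ W₂),
      finrank (ZMod ℓ) (W₂ ⧸ W₁.comap W₂.subtype) = 2 ∧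
      W₁.comap W₂.subtype ≠ ⊤ ∧
      (∀ X : Submodule (ZMod ℓ) (W₂ ⧸ W₁.comap W₂.subtype),
        (∀ g : G, ∀ x ∈ X, repFactorMap ρ W₁ W₂ h1 h2 g x ∈ X) → X = ⊥ ∨ X = ⊤) ∧
      (∀ g : G, LinearMap.det (repFactorMap ρ W₁ W₂ h1 h2 g) = (χ g : ZMod ℓ)) := by
  obtain ⟨U, hUinv, hUirr, hUdim⟩ := hU
  have hB : B.IsAlt := halt
  have hinv' : RepInvariant ρ (B.orthogonal U) := hUinv.orthogonal hsim
  have horth := LinearMap.BilinForm.finrank_orthogonal hnd U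
  have hdouble := LinearMap.BilinForm.orthogonal_orthogonal hnd hB.isRefl U
  suffices H : ∃ W : Submodule (ZMod ℓ) V, RepInvariant ρ W ∧
      finrank (ZMod ℓ) W = finrank (ZMod ℓ) (W ⊓ B.orthogonal W : Submodule (ZMod ℓ) V) + 2 by
    obtain ⟨W, hW, hrk⟩ := H
    have hrad := hW.inf (hW.orthogonal hsim)
    have hfin : finrank (ZMod ℓ) (W ⧸ (W ⊓ B.orthogonal W).comap W.subtype) = 2 := by
      have := finrank_subquotient_add_finrank (inf_le_left : W ⊓ B.orthogonal W ≤ W)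
      omega
    obtain ⟨w, hw, hwn⟩ : ∃ w ∈ W, w ∉ B.orthogonal W := by
      by_contra! hcon
      rw [inf_eq_left.mpr hcon] at hrk
      omega
    rw [LinearMap.BilinForm.mem_orthogonal_iff] at hwn
    push Not at hwn
    obtain ⟨v, hv, hvw⟩ := hwn
    refine ⟨W ⊓ B.orthogonal W, W, inf_le_left, hrad, hW, hfin, fun htop => ?_,
      eq_bot_or_eq_top_of_finrank_subquotient_eq_two hno1 hrad hW hfin,
      det_repFactorMap_eq_multiplier hB hsim hrad hW hfin inf_le_right hv hw hvw⟩
    rw [htop, finrank_zero_of_subsingleton] at hfin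
    omega
  rcases hUirr.2 _ inf_le_left (hUinv.inf hinv') with hbot | htop
  · rcases hUdim with hd | hd
    · exact ⟨U, hUinv, by rw [hbot, finrank_bot, hd]⟩
    · exact ⟨_, hinv', by rw [hdouble, inf_comm, hbot, finrank_bot]; omega⟩
  · have hle := Submodule.finrank_mono (inf_eq_left.mp htop)
    exact ⟨_, hinv', by rw [hdouble, inf_comm, htop]; omega⟩
end

section
/- Let p and ℓ be distinct primes and α, β, γ ∈ ℤ, and set P(x) = x^6 + αx^5 + βx^4 + γx^3 + pβx^2 + p²αx + p³ ∈ ℤ[x]. Suppose ℓ does not divide (p−1)(p+1−α), and suppose a, b ∈ F_ℓ satisfy P̄(x) = (x³ + ax² + bx − p̄)(x³ − bx² − p̄ax − p̄²) in F_ℓ[x], where P̄ is the reduction of P modulo ℓ and p̄ the image of p. Then b equals the image in F_ℓ of the rational number δ = (−p²α + p² + pα² − pα − pβ + p − β + γ)/((p−1)(p+1−α)) (well-defined since the denominator is invertible modulo ℓ), and a = b + ᾱ. -/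
open Polynomial

/-- Let `p ≠ ℓ` be primes, `P(x) = x^6 + αx^5 + βx^4 + γx^3 + pβx^2 + p²αx + p³ ∈ ℤ[x]`,
and suppose `ℓ ∤ (p-1)(p+1-α)`. If `a, b ∈ F_ℓ` satisfy
`P̄ = (x³ + ax² + bx − p̄)(x³ − bx² − p̄ax − p̄²)` in `F_ℓ[x]`, then `b` is the image in
`F_ℓ` of `δ = (−p²α + p² + pα² − pα − pβ + p − β + γ)/((p−1)(p+1−α))` and `a = b + ᾱ`. -/
theorem stmt_7 (p ℓ : ℕ) [Fact p.Prime] [Fact ℓ.Prime] (hne : p ≠ ℓ) (α β γ : ℤ)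
    (P : ℤ[X])
    (hP : P = X ^ 6 + C α * X ^ 5 + C β * X ^ 4 + C γ * X ^ 3 +
      C ((p : ℤ) * β) * X ^ 2 + C ((p : ℤ) ^ 2 * α) * X + C ((p : ℤ) ^ 3))
    (hℓnd : ¬ (ℓ : ℤ) ∣ ((p : ℤ) - 1) * ((p : ℤ) + 1 - α))
    (a b : ZMod ℓ)
    (hfac : P.map (Int.castRingHom (ZMod ℓ)) =
      (X ^ 3 + C a * X ^ 2 + C b * X - C ((p : ZMod ℓ))) *
      (X ^ 3 - C b * X ^ 2 - C ((p : ZMod ℓ) * a) * X - C ((p : ZMod ℓ) ^ 2))) :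
    b = ((-(p : ℤ) ^ 2 * α + (p : ℤ) ^ 2 + (p : ℤ) * α ^ 2 - (p : ℤ) * α - (p : ℤ) * β +
          (p : ℤ) - β + γ : ℤ) : ZMod ℓ) /
        ((((p : ℤ) - 1) * ((p : ℤ) + 1 - α) : ℤ) : ZMod ℓ) ∧
      a = b + (α : ZMod ℓ) := by
  have hexp : (X ^ 3 + C a * X ^ 2 + C b * X - C ((p : ZMod ℓ))) *
      (X ^ 3 - C b * X ^ 2 - C ((p : ZMod ℓ) * a) * X - C ((p : ZMod ℓ) ^ 2)) =
      X ^ 6 + C (a - b) * X ^ 5 + C (b - a * b - p * a) * X ^ 4 +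
      C (-(p : ZMod ℓ) ^ 2 - p * a ^ 2 - b ^ 2 - p) * X ^ 3 +
      C (p * (b - a * b - p * a)) * X ^ 2 + C ((p : ZMod ℓ) ^ 2 * (a - b)) * X +
      C ((p : ZMod ℓ) ^ 3) := by
    simp only [map_sub, map_mul, map_pow, map_neg]
    ring
  rw [hP, hexp] at hfac
  simp only [Polynomial.map_add, Polynomial.map_mul, Polynomial.map_pow, map_X, map_C] at hfac
  have h5 := congrArg (coeff · 5) hfac
  have h4 := congrArg (coeff · 4) hfac
  have h3 := congrArg (coeff · 3) hfac
  simp only [coeff_add, coeff_C_mul, coeff_X_pow, coeff_X, coeff_C] at h5 h4 h3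
  norm_num at h5 h4 h3
  have hden : ((((p : ℤ) - 1) * ((p : ℤ) + 1 - α) : ℤ) : ZMod ℓ) ≠ 0 := by
    rwa [Ne, ZMod.intCast_zmod_eq_zero_iff_dvd]
  refine ⟨?_, by linear_combination -h5⟩
  rw [eq_div_iff hden]
  push_cast
  rw [h5, h4, h3]
  ring
end

section
/- Let p and ℓ be distinct primes and α, β, γ ∈ ℤ, and set P(x) = x^6 + αx^5 + βx^4 + γx^3 + pβx^2 + p²αx + p³ ∈ ℤ[x]. Suppose ℓ does not divide (p³−1)(p³+1−pα), and suppose a, b ∈ F_ℓ satisfy P̄(x) = (x³ + ax² + bx − 1)(x³ − p̄bx² − p̄²ax − p̄³) in F_ℓ[x], where P̄ is the reduction of P modulo ℓ and p̄ the image of p. Then b equals the image in F_ℓ of the rational number δ' = (−p⁵α + p⁴ + p³α² − p³β − p²α + pγ + p − β)/((p³−1)(p³+1−pα)) (well-defined since the denominator is invertible modulo ℓ), and a = p̄b + ᾱ. -/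
open Polynomial

/-- Let `p ≠ ℓ` be primes, `P(x) = x^6 + αx^5 + βx^4 + γx^3 + pβx^2 + p²αx + p³ ∈ ℤ[x]`,
and suppose `ℓ ∤ (p³−1)(p³+1−pα)`. If `a, b ∈ F_ℓ` satisfy
`P̄ = (x³ + ax² + bx − 1)(x³ − p̄bx² − p̄²ax − p̄³)` in `F_ℓ[x]`, then `b` is the image in
`F_ℓ` of `δ' = (−p⁵α + p⁴ + p³α² − p³β − p²α + pγ + p − β)/((p³−1)(p³+1−pα))` and
`a = p̄b + ᾱ`. -/
theorem stmt_9 (p ℓ : ℕ) [Fact p.Prime] [Fact ℓ.Prime] (hne : p ≠ ℓ) (α β γ : ℤ)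
    (P : ℤ[X])
    (hP : P = X ^ 6 + C α * X ^ 5 + C β * X ^ 4 + C γ * X ^ 3 +
      C ((p : ℤ) * β) * X ^ 2 + C ((p : ℤ) ^ 2 * α) * X + C ((p : ℤ) ^ 3))
    (hℓnd : ¬ (ℓ : ℤ) ∣ ((p : ℤ) ^ 3 - 1) * ((p : ℤ) ^ 3 + 1 - (p : ℤ) * α))
    (a b : ZMod ℓ)
    (hfac : P.map (Int.castRingHom (ZMod ℓ)) =
      (X ^ 3 + C a * X ^ 2 + C b * X - C (1 : ZMod ℓ)) *
      (X ^ 3 - C ((p : ZMod ℓ) * b) * X ^ 2 - C ((p : ZMod ℓ) ^ 2 * a) * X -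
        C ((p : ZMod ℓ) ^ 3))) :
    b = ((-(p : ℤ) ^ 5 * α + (p : ℤ) ^ 4 + (p : ℤ) ^ 3 * α ^ 2 - (p : ℤ) ^ 3 * β -
          (p : ℤ) ^ 2 * α + (p : ℤ) * γ + (p : ℤ) - β : ℤ) : ZMod ℓ) /
        ((((p : ℤ) ^ 3 - 1) * ((p : ℤ) ^ 3 + 1 - (p : ℤ) * α) : ℤ) : ZMod ℓ) ∧
      a = (p : ZMod ℓ) * b + (α : ZMod ℓ) := by
  have hD : ((((p : ℤ) ^ 3 - 1) * ((p : ℤ) ^ 3 + 1 - (p : ℤ) * α) : ℤ) : ZMod ℓ) ≠ 0 :=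
    fun h => hℓnd ((ZMod.intCast_zmod_eq_zero_iff_dvd _ ℓ).1 h)
  have hprod : (X ^ 3 + C a * X ^ 2 + C b * X - C (1 : ZMod ℓ)) *
      (X ^ 3 - C ((p : ZMod ℓ) * b) * X ^ 2 - C ((p : ZMod ℓ) ^ 2 * a) * X -
        C ((p : ZMod ℓ) ^ 3)) =
      X ^ 6 + C (a - p * b) * X ^ 5 + C (b - p ^ 2 * a - p * a * b) * X ^ 4 +
        C (-(p : ZMod ℓ) ^ 3 - p ^ 2 * a ^ 2 - p * b ^ 2 - 1) * X ^ 3 +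
        C (p * b - p ^ 3 * a - p ^ 2 * a * b) * X ^ 2 +
        C (p ^ 2 * a - p ^ 3 * b) * X + C ((p : ZMod ℓ) ^ 3) := by
    simp only [map_sub, map_mul, map_pow, map_neg, map_one]
    ring
  rw [hprod, hP] at hfac
  have h5 := congrArg (coeff · 5) hfac
  have h4 := congrArg (coeff · 4) hfac
  have h3 := congrArg (coeff · 3) hfac
  simp only [coeff_map, coeff_add, coeff_C_mul, coeff_X_pow, coeff_X, coeff_C] at h5 h4 h3
  norm_num at h5 h4 h3
  have ha : a = (p : ZMod ℓ) * b + (α : ZMod ℓ) := by linear_combination -h5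
  refine ⟨?_, ha⟩
  rw [eq_div_iff hD]
  push_cast
  subst ha
  linear_combination ((p : ZMod ℓ) ^ 3 + 1) * h4 - (p : ZMod ℓ) * h3
end

section
/- Let ℓ ≥ 2 be an integer and let n₁ < n₂ be positive integers. Then (ℓ^{n₁} − 1)(ℓ^{n₂} − 1) / gcd(ℓ^{n₁} − 1, ℓ^{n₂} − 1)² > ℓ. (Here the left-hand side is an integer, being lcm(ℓ^{n₁} − 1, ℓ^{n₂} − 1)/gcd(ℓ^{n₁} − 1, ℓ^{n₂} − 1).) -/
/-- For an integer `ℓ ≥ 2` and positive integers `n₁ < n₂`,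
`(ℓ^{n₁} − 1)(ℓ^{n₂} − 1) / gcd(ℓ^{n₁} − 1, ℓ^{n₂} − 1)² > ℓ`. -/
theorem stmt_11 (ℓ n₁ n₂ : ℕ) (hℓ : 2 ≤ ℓ) (hn₁ : 0 < n₁) (h12 : n₁ < n₂) :
    ℓ < (ℓ ^ n₁ - 1) * (ℓ ^ n₂ - 1) / Nat.gcd (ℓ ^ n₁ - 1) (ℓ ^ n₂ - 1) ^ 2 := by
  rw [Nat.pow_sub_one_gcd_pow_sub_one]
  have hd : 0 < n₁.gcd n₂ := Nat.gcd_pos_of_pos_left _ hn₁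
  have hd₁ : n₁.gcd n₂ ≤ n₁ := Nat.gcd_le_left _ hn₁
  have hd₂ : 2 * n₁.gcd n₂ ≤ n₂ := by
    obtain ⟨b, hb⟩ := Nat.gcd_dvd_right n₁ n₂
    have : 1 < b := by
      by_contra! h
      nlinarith
    nlinarith
  generalize n₁.gcd n₂ = d at hd hd₁ hd₂
  have hx : ℓ ≤ ℓ ^ d := Nat.le_self_pow hd.ne' ℓ
  have h₁ : ℓ ^ d - 1 ≤ ℓ ^ n₁ - 1 :=
    Nat.sub_le_sub_right (Nat.pow_le_pow_right (by omega) hd₁) 1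
  have h₂ : (ℓ + 1) * (ℓ ^ d - 1) ≤ ℓ ^ n₂ - 1 :=
    calc (ℓ + 1) * (ℓ ^ d - 1) ≤ (ℓ ^ d + 1) * (ℓ ^ d - 1) := by gcongr
      _ = ℓ ^ (2 * d) - 1 := by rw [← Nat.sq_sub_sq, one_pow, ← pow_mul, mul_comm d]
      _ ≤ ℓ ^ n₂ - 1 := Nat.sub_le_sub_right (Nat.pow_le_pow_right (by omega) hd₂) 1
  have hpos : 0 < (ℓ ^ d - 1) ^ 2 := pow_pos (by omega) 2
  rw [← Nat.succ_le_iff, Nat.le_div_iff_mul_le hpos]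
  calc (ℓ + 1) * (ℓ ^ d - 1) ^ 2 = (ℓ ^ d - 1) * ((ℓ + 1) * (ℓ ^ d - 1)) := by ring
    _ ≤ (ℓ ^ n₁ - 1) * (ℓ ^ n₂ - 1) := Nat.mul_le_mul h₁ h₂
end

section
/- Let ℓ ≥ 3 and n ≥ 1 be integers, let r be an integer with 1 ≤ r ≤ ℓ − 2, and let a_0, ..., a_{n−1} and b_0, ..., b_{n−1} be integers each equal to 0 or 1. If ℓ^n − 1 divides r·Σ_{i=0}^{n−1} (a_i − b_i)ℓ^i, then a_i = b_i for all i = 0, ..., n−1. -/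
theorem abs_sum_mul_pow_mul_sub_one_le {L : ℤ} (hL : 1 ≤ L) {c : ℕ → ℤ} {n : ℕ}
    (hc : ∀ i < n, |c i| ≤ 1) :
    |∑ i ∈ Finset.range n, c i * L ^ i| * (L - 1) ≤ L ^ n - 1 := by
  have hpow : ∀ i, 0 ≤ L ^ i := fun i => by positivity
  calc |∑ i ∈ Finset.range n, c i * L ^ i| * (L - 1)
      ≤ (∑ i ∈ Finset.range n, L ^ i) * (L - 1) := by
        refine mul_le_mul_of_nonneg_right ?_ (by linarith)
        refine (Finset.abs_sum_le_sum_abs _ _).trans (Finset.sum_le_sum fun i hi => ?_)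
        rw [abs_mul, abs_of_nonneg (hpow i)]
        exact mul_le_of_le_one_left (hpow i) (hc i (Finset.mem_range.mp hi))
    _ = L ^ n - 1 := geom_sum_mul L n

theorem eq_zero_of_sum_mul_pow_eq_zero {L : ℤ} (hL : 2 ≤ L) {c : ℕ → ℤ} {n : ℕ}
    (hc : ∀ i < n, |c i| ≤ 1) (hsum : ∑ i ∈ Finset.range n, c i * L ^ i = 0) :
    ∀ i < n, c i = 0 := by
  induction n with
  | zero => simp
  | succ n ih =>
    have hlow : ∀ i < n, |c i| ≤ 1 := fun i hi => hc i (hi.trans n.lt_succ_self)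
    rw [Finset.sum_range_succ] at hsum
    have hpow : 0 < L ^ n := by positivity
    have htop : c n = 0 := by
      by_contra hne
      have hbound := abs_sum_mul_pow_mul_sub_one_le (by linarith : 1 ≤ L) hlow
      rw [eq_neg_of_add_eq_zero_left hsum, abs_neg, abs_mul, abs_of_pos hpow] at hbound
      have : 1 ≤ |c n| := Int.one_le_abs hne
      have h₁ : L ^ n ≤ |c n| * L ^ n := le_mul_of_one_le_left hpow.le this
      have h₂ : |c n| * L ^ n ≤ |c n| * L ^ n * (L - 1) :=
        le_mul_of_one_le_right (by positivity) (by linarith)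
      linarith
    rw [htop, zero_mul, add_zero] at hsum
    intro i hi
    rcases Nat.lt_succ_iff_lt_or_eq.mp hi with h | rfl
    · exact ih hlow hsum i h
    · exact htop


/-- Let `ℓ ≥ 3`, `n ≥ 1`, `1 ≤ r ≤ ℓ − 2`, and let `a_i, b_i ∈ {0, 1}` for `i < n`.
If `ℓ^n − 1` divides `r·Σ_{i<n} (a_i − b_i)ℓ^i`, then `a_i = b_i` for all `i < n`. -/
theorem stmt_12 (ℓ n : ℕ) (hℓ : 3 ≤ ℓ) (hn : 1 ≤ n) (r : ℤ)
    (hr1 : 1 ≤ r) (hr2 : r ≤ (ℓ : ℤ) - 2)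
    (a b : ℕ → ℤ) (ha : ∀ i < n, a i = 0 ∨ a i = 1) (hb : ∀ i < n, b i = 0 ∨ b i = 1)
    (hdvd : ((ℓ : ℤ) ^ n - 1) ∣ r * ∑ i ∈ Finset.range n, (a i - b i) * (ℓ : ℤ) ^ i) :
    ∀ i < n, a i = b i := by
  have hL : (3 : ℤ) ≤ ℓ := by exact_mod_cast hℓ
  have hc : ∀ i < n, |a i - b i| ≤ 1 := fun i hi => by
    rcases ha i hi with h | h <;> rcases hb i hi with h' | h' <;> simp [h, h']
  have hbound := abs_sum_mul_pow_mul_sub_one_le (by linarith : (1 : ℤ) ≤ ℓ) hc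
  have hpow : (1 : ℤ) < (ℓ : ℤ) ^ n := one_lt_pow₀ (by linarith) (by lia)
  have hsum : ∑ i ∈ Finset.range n, (a i - b i) * (ℓ : ℤ) ^ i = 0 := by
    set S := ∑ i ∈ Finset.range n, (a i - b i) * (ℓ : ℤ) ^ i
    by_contra hS
    have hSpos : 0 < |S| := abs_pos.mpr hS
    have hlt : |r * S| < (ℓ : ℤ) ^ n - 1 := by
      rw [abs_mul, abs_of_pos (by linarith : 0 < r)]
      nlinarith
    have hzero := Int.eq_zero_of_abs_lt_dvd hdvd hlt
    exact (mul_ne_zero (by linarith) hS) hzero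
  exact fun i hi =>
    sub_eq_zero.mp (eq_zero_of_sum_mul_pow_eq_zero (by linarith) hc hsum i hi)
end

section
/- Let J ∈ GL_6(F_3) be the standard symplectic matrix (the matrix of the standard nondegenerate alternating form on F_3^6), let Sp_6(F_3) = {M ∈ GL_6(F_3) : MᵀJM = J}, and let GSp_6(F_3) = {M ∈ GL_6(F_3) : MᵀJM = cJ for some c ∈ F_3^×}. If G is a subgroup of GSp_6(F_3) whose order is divisible by 2³ · 3² · 5 · 7 · 13, then G = Sp_6(F_3) or G = GSp_6(F_3). -/
open Matrix

/-- A faithful action of `H` by isometries of a symplectic space with `3 ^ 6` elements. -/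
structure IsSymplecticAction (H : Type*) {V : Type*} [Group H] [AddCommGroup V]
    [Module (ZMod 3) V] [DistribMulAction H V] (ω : LinearMap.BilinForm (ZMod 3) V) : Prop where
  card : Nat.card V = 3 ^ 6
  alt : ∀ v, ω v v = 0
  nondeg : ∀ v, (∀ w, ω v w = 0) → v = 0
  inv : ∀ (h : H) (v w : V), ω (h • v) (h • w) = ω v w
  faithful : ∀ h : H, (∀ v : V, h • v = v) → h = 1

section FixedPoints

variable {H α : Type*} [Group H] [MulAction H α]

theorem IsPGroup.card_modEq_card_fixed {p : ℕ} [Fact p.Prime] [Finite α] {P : Subgroup H}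
    (hP : IsPGroup p P) (S : Set α) (hS : ∀ h ∈ P, ∀ s ∈ S, h • s ∈ S) :
    Nat.card S ≡ Nat.card {s | s ∈ S ∧ ∀ h ∈ P, h • s = s} [MOD p] := by
  let T : SubMulAction P α := ⟨S, fun {c x} hx => hS c c.2 x hx⟩
  have h := hP.card_modEq_card_fixedPoints T
  have e : MulAction.fixedPoints P T ≃ {s | s ∈ S ∧ ∀ h ∈ P, h • s = s} :=
    { toFun := fun x => ⟨x.1.1, x.1.2, fun h hh => congrArg Subtype.val (x.2 ⟨h, hh⟩)⟩
      invFun := fun y => ⟨⟨y.1, y.2.1⟩, fun h => Subtype.ext (y.2.2 h h.2)⟩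
      left_inv := fun x => rfl
      right_inv := fun y => rfl }
  rw [← Nat.card_congr e]
  exact h

theorem card_modEq_card_fixed_of_pow_eq_one {p : ℕ} [Fact p.Prime] [Finite α] {g : H}
    (hg : g ^ p = 1) (S : Set α) (hS : ∀ s ∈ S, g • s ∈ S) :
    Nat.card S ≡ Nat.card {s | s ∈ S ∧ g • s = s} [MOD p] := by
  have hfin : IsOfFinOrder g := isOfFinOrder_iff_pow_eq_one.2 ⟨p, (Fact.out : p.Prime).pos, hg⟩
  have hz : ∀ h ∈ Subgroup.zpowers g, ∃ n : ℕ, g ^ n = h := fun h hh =>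
    (hfin.mem_powers_iff_mem_zpowers).2 hh
  have hP : IsPGroup p (Subgroup.zpowers g) := by
    rintro ⟨h, hh⟩
    obtain ⟨n, rfl⟩ := hz h hh
    exact ⟨1, Subtype.ext (by simp [pow_right_comm _ n p, hg])⟩
  convert hP.card_modEq_card_fixed S ?_ using 5 with s
  · refine and_congr_right fun _ => ⟨fun h x hx => ?_, fun h => h g (Subgroup.mem_zpowers g)⟩
    obtain ⟨n, rfl⟩ := hz x hx
    exact (MulAction.mem_stabilizer_iff (a := s)).1
      (pow_mem (MulAction.mem_stabilizer_iff.2 h) n)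
  · intro x hx
    obtain ⟨n, rfl⟩ := hz x hx
    induction n with
    | zero => simp
    | succ n ih =>
      intro s hs
      rw [pow_succ', mul_smul]
      exact hS _ (ih (pow_mem (Subgroup.mem_zpowers g) n) s hs)

end FixedPoints

namespace IsSymplecticAction

variable {H V : Type*} [Group H] [AddCommGroup V] [Module (ZMod 3) V] [DistribMulAction H V]
  {ω : LinearMap.BilinForm (ZMod 3) V}

theorem smul_zmod_smul (h : H) (c : ZMod 3) (v : V) : h • (c • v) = c • (h • v) :=
  ZMod.map_smul (DistribSMul.toAddMonoidHom V h) c v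

theorem skew (hω : IsSymplecticAction H ω) (v w : V) : ω v w = - ω w v := by
  have h := hω.alt (v + w)
  simp only [map_add, LinearMap.add_apply, hω.alt] at h
  linear_combination h

theorem finite (hω : IsSymplecticAction H ω) : Finite V :=
  Nat.finite_of_card_ne_zero (by rw [hω.card]; norm_num)

theorem restrict (hω : IsSymplecticAction H ω) (L : Subgroup H) : IsSymplecticAction L ω where
  card := hω.card
  alt := hω.alt
  nondeg := hω.nondeg
  inv h := hω.inv h
  faithful h hh := Subtype.ext (hω.faithful h hh)

/-- The additive subgroup of vectors fixed by `h`. -/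
def fixed (V : Type*) [AddCommGroup V] [DistribMulAction H V] (h : H) : AddSubgroup V where
  carrier := {v | h • v = v}
  add_mem' {a b} ha hb := by
    simp only [Set.mem_ofPred_eq] at *
    rw [smul_add, ha, hb]
  zero_mem' := smul_zero h
  neg_mem' {a} ha := by
    simp only [Set.mem_ofPred_eq] at *
    rw [smul_neg, ha]

omit [Module (ZMod 3) V] in
@[simp]
theorem mem_fixed {h : H} {v : V} : v ∈ fixed V h ↔ h • v = v := Iff.rfl

theorem card_addSubgroup (hω : IsSymplecticAction H ω) (A : AddSubgroup V) :
    ∃ d ≤ 6, Nat.card A = 3 ^ d :=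
  (Nat.dvd_prime_pow Nat.prime_three).1 (hω.card ▸ A.card_addSubgroup_dvd_card)

theorem card_modEq_card_inf_fixed (hω : IsSymplecticAction H ω) {p : ℕ} [Fact p.Prime] {g : H}
    (hg : g ^ p = 1) (A : AddSubgroup V) (hA : ∀ a ∈ A, g • a ∈ A) :
    Nat.card A ≡ Nat.card (A ⊓ fixed V g : AddSubgroup V) [MOD p] :=
  have := hω.finite
  card_modEq_card_fixed_of_pow_eq_one hg (A : Set V) hA

theorem card_modEq_card_fixed (hω : IsSymplecticAction H ω) {p : ℕ} [Fact p.Prime] {g : H}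
    (hg : g ^ p = 1) : 3 ^ 6 ≡ Nat.card (fixed V g) [MOD p] := by
  have h := hω.card_modEq_card_inf_fixed hg ⊤ (by simp)
  rwa [top_inf_eq, AddSubgroup.card_top, hω.card] at h

theorem eq_top_of_card (hω : IsSymplecticAction H ω) {A : AddSubgroup V}
    (hA : Nat.card A = 3 ^ 6) : A = ⊤ :=
  have := hω.finite
  AddSubgroup.eq_top_of_card_eq A (hA.trans hω.card.symm)

theorem fixed_ne_top (hω : IsSymplecticAction H ω) {g : H} (hg : g ≠ 1) : fixed V g ≠ ⊤ :=
  fun h => hg (hω.faithful g fun v => by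
    have : v ∈ fixed V g := h ▸ AddSubgroup.mem_top v
    exact this)

omit [Module (ZMod 3) V] in
theorem eq_bot_of_card {A : AddSubgroup V} (hA : Nat.card A = 3 ^ 0) : A = ⊥ :=
  AddSubgroup.card_eq_one.1 hA

theorem fixed_eq_bot_of_pow_seven (hω : IsSymplecticAction H ω) {g : H} (hg : g ≠ 1)
    (hg7 : g ^ 7 = 1) : fixed V g = ⊥ := by
  have : Fact (Nat.Prime 7) := ⟨by norm_num⟩
  have h := hω.card_modEq_card_fixed hg7
  obtain ⟨d, hd, hc⟩ := hω.card_addSubgroup (fixed V g)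
  rw [hc] at h
  have h6 : d ≠ 6 := fun h6 => hω.fixed_ne_top hg (hω.eq_top_of_card (h6 ▸ hc))
  have h0 : d = 0 := by
    revert h h6
    interval_cases d <;> decide
  exact eq_bot_of_card (h0 ▸ hc)

theorem eq_bot_or_eq_top_of_pow_seven (hω : IsSymplecticAction H ω) {g : H} (hg : g ≠ 1)
    (hg7 : g ^ 7 = 1) {A : AddSubgroup V} (hA : ∀ a ∈ A, g • a ∈ A) : A = ⊥ ∨ A = ⊤ := by
  have : Fact (Nat.Prime 7) := ⟨by norm_num⟩
  have h := hω.card_modEq_card_inf_fixed hg7 A hA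
  rw [hω.fixed_eq_bot_of_pow_seven hg hg7, inf_bot_eq, AddSubgroup.card_bot] at h
  obtain ⟨d, hd, hc⟩ := hω.card_addSubgroup A
  rw [hc] at h
  have : d = 0 ∨ d = 6 := by
    revert h
    interval_cases d <;> decide
  rcases this with rfl | rfl
  · exact Or.inl (eq_bot_of_card hc)
  · exact Or.inr (hω.eq_top_of_card hc)

/-- The form is nondegenerate on the fixed space of an element of order prime to `3`. -/
theorem exists_mem_fixed_ne_zero (hω : IsSymplecticAction H ω) {g : H} {p : ℕ}
    (hp : (p : ZMod 3) ≠ 0) (hg : g ^ p = 1) {u : V} (hu : g • u = u) (hu0 : u ≠ 0) :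
    ∃ y, g • y = y ∧ ω u y ≠ 0 := by
  by_contra! hcon
  refine hu0 (hω.nondeg u fun w => ?_)
  have hgu (i : ℕ) : g ^ i • u = u :=
    (MulAction.mem_stabilizer_iff (a := u)).1 (pow_mem (MulAction.mem_stabilizer_iff.2 hu) i)
  have hfix : g • (∑ i ∈ Finset.range p, g ^ i • w) = ∑ i ∈ Finset.range p, g ^ i • w := by
    rw [Finset.smul_sum]
    have h1 := Finset.sum_range_succ' (fun i => g ^ i • w) p
    rw [Finset.sum_range_succ] at h1
    simp only [hg, pow_zero, add_left_inj] at h1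
    rw [h1]
    simp [pow_succ', mul_smul]
  have h := hcon _ hfix
  rw [map_sum, Finset.sum_congr rfl (fun i _ => show ω u (g ^ i • w) = ω u w by
    conv_lhs => rw [← hgu i]
    exact hω.inv _ _ _)] at h
  simpa [hp] using h

theorem fixed_eq_bot_of_pow_thirteen (hω : IsSymplecticAction H ω) {g : H} (hg : g ≠ 1)
    (hg13 : g ^ 13 = 1) : fixed V g = ⊥ := by
  have : Fact (Nat.Prime 13) := ⟨by norm_num⟩
  have h := hω.card_modEq_card_fixed hg13
  obtain ⟨d, hd, hc⟩ := hω.card_addSubgroup (fixed V g)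
  rw [hc] at h
  have h6 : d ≠ 6 := fun h6 => hω.fixed_ne_top hg (hω.eq_top_of_card (h6 ▸ hc))
  have h0 : d = 0 ∨ d = 3 := by
    revert h h6
    interval_cases d <;> decide
  rcases h0 with rfl | rfl
  · exact eq_bot_of_card hc
  exfalso
  let F : Submodule (ZMod 3) V := AddSubgroup.toZModSubmodule 3 (fixed V g)
  have : Finite V := hω.finite
  have hF : Module.finrank (ZMod 3) F = 3 := by
    have h3 := Module.natCard_eq_pow_finrank (K := ZMod 3) (V := F)
    rw [show Nat.card F = 3 ^ 3 from hc, Nat.card_zmod] at h3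
    exact (Nat.pow_right_injective (le_of_lt (by norm_num)) h3).symm
  let b : Module.Basis (Fin 3) (ZMod 3) F := Module.finBasisOfFinrankEq _ _ hF
  let M : Matrix (Fin 3) (Fin 3) (ZMod 3) := fun i j => ω (b i) (b j)
  have hM : Mᵀ = -M := by
    ext i j
    exact hω.skew _ _
  have hdet : M.det = 0 := by
    have := congrArg Matrix.det hM
    rw [Matrix.det_transpose, Matrix.det_neg] at this
    simp only [Fintype.card_fin] at this
    revert this
    generalize M.det = x
    revert x
    decide
  obtain ⟨c, hc0, hcM⟩ := Matrix.exists_vecMul_eq_zero_iff.2 hdet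
  set u : F := ∑ i, c i • b i with hu
  have hu0 : u ≠ 0 := by
    intro h0
    exact hc0 (funext fun i => by
      simpa using Fintype.linearIndependent_iff.1 b.linearIndependent c (hu ▸ h0) i)
  obtain ⟨y, hy, hy0⟩ := hω.exists_mem_fixed_ne_zero (p := 13) (by decide) hg13
    (show g • (u : V) = u from u.2) (by simpa using hu0)
  refine hy0 ?_
  have hlin : (ω (u : V)).comp F.subtype = 0 := by
    refine b.ext fun j => ?_
    have := congrFun hcM j
    simp only [Matrix.vecMul, dotProduct, Pi.zero_apply] at this
    simp only [LinearMap.comp_apply, Submodule.subtype_apply, LinearMap.zero_apply]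
    rw [← this, hu]
    simp [M, map_sum, LinearMap.sum_apply]
  exact LinearMap.congr_fun hlin ⟨y, hy⟩

/-- The additive subgroup of vectors orthogonal to `u`. -/
def perp (ω : LinearMap.BilinForm (ZMod 3) V) (u : V) : AddSubgroup V :=
  (ω u).toAddMonoidHom.ker

@[simp]
theorem mem_perp {u w : V} : w ∈ perp ω u ↔ ω u w = 0 := Iff.rfl

theorem exists_ne_zero (hω : IsSymplecticAction H ω) {u : V} (hu : u ≠ 0) : ∃ y, ω u y ≠ 0 := by
  by_contra! h
  exact hu (hω.nondeg u h)

theorem card_perp (hω : IsSymplecticAction H ω) {u : V} (hu : u ≠ 0) :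
    Nat.card (perp ω u) = 3 ^ 5 := by
  have : Finite V := hω.finite
  have h1 := (perp ω u).card_mul_index
  rw [perp, AddSubgroup.index_ker, hω.card] at h1
  obtain ⟨y, hy⟩ := hω.exists_ne_zero hu
  have h2 : (ω u).toAddMonoidHom.range = ⊤ := by
    rw [AddMonoidHom.range_eq_top]
    intro c
    refine ⟨(c / ω u y) • y, ?_⟩
    simp [hy]
  rw [h2, AddSubgroup.card_top, Nat.card_zmod] at h1
  rw [perp]
  omega

theorem exists_smul_of_card (hω : IsSymplecticAction H ω) {u : V} (hu : u ≠ 0)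
    {A : AddSubgroup V} (huA : u ∈ A) (hA : Nat.card A = 3) {a : V} (ha : a ∈ A) :
    ∃ c : ZMod 3, a = c • u := by
  have : Finite V := hω.finite
  have h3 : addOrderOf u = 3 :=
    addOrderOf_eq_prime (by simpa using (ZModModule.char_nsmul_eq_zero 3 u)) hu
  have hle : AddSubgroup.zmultiples u ≤ A := by simpa using huA
  have heq := AddSubgroup.eq_of_le_of_card_ge hle (by rw [hA, Nat.card_zmultiples, h3])
  rw [← heq] at ha
  obtain ⟨k, rfl⟩ := AddSubgroup.mem_zmultiples_iff.1 ha
  exact ⟨k, (Int.cast_smul_eq_zsmul _ _ _).symm⟩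

theorem card_of_le_line (hω : IsSymplecticAction H ω) {u : V} {A : AddSubgroup V}
    (h : ∀ a ∈ A, ∃ c : ZMod 3, a = c • u) : Nat.card A ≤ 3 := by
  have : Finite V := hω.finite
  choose f hf using fun a : A => h a a.2
  have hinj : Function.Injective f := fun a b hab => Subtype.ext (by rw [hf a, hf b, hab])
  simpa using Nat.card_le_card_of_injective f hinj

/-- The vectors fixed by an element of order five and orthogonal to one of them, `u`, form the line
of `u`. -/
theorem card_perp_inf_fixed (hω : IsSymplecticAction H ω) {g : H} (hg : g ≠ 1) (hg5 : g ^ 5 = 1)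
    {u : V} (hu : u ≠ 0) (hgu : g • u = u) :
    Nat.card (perp ω u ⊓ fixed V g : AddSubgroup V) = 3 := by
  have : Finite V := hω.finite
  have : Fact (Nat.Prime 5) := ⟨by norm_num⟩
  have h := hω.card_modEq_card_fixed hg5
  obtain ⟨d, hd, hc⟩ := hω.card_addSubgroup (fixed V g)
  rw [hc] at h
  have h6 : d ≠ 6 := fun h6 => hω.fixed_ne_top hg (hω.eq_top_of_card (h6 ▸ hc))
  have h2 : d = 2 := by
    revert h h6
    interval_cases d <;> decide
  subst h2
  obtain ⟨y, hy, hy0⟩ := hω.exists_mem_fixed_ne_zero (p := 5) (by decide) hg5 hgu hu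
  obtain ⟨e, he, hce⟩ := hω.card_addSubgroup (perp ω u ⊓ fixed V g)
  have hle : perp ω u ⊓ fixed V g ≤ fixed V g := inf_le_right
  have hdvd := AddSubgroup.card_dvd_of_le hle
  rw [hce, hc] at hdvd
  have he2 := (Nat.pow_dvd_pow_iff_le_right (by norm_num)).1 hdvd
  have hne2 : e ≠ 2 := by
    rintro rfl
    have := AddSubgroup.eq_of_le_of_card_ge hle (by rw [hc, hce])
    exact hy0 (this.ge hy).1
  have hne0 : e ≠ 0 := by
    rintro rfl
    have := eq_bot_of_card hce
    exact hu (AddSubgroup.mem_bot.1 (this ▸ ⟨hω.alt u, hgu⟩))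
  rw [hce, show e = 1 by omega, pow_one]

theorem line_or_eq_perp (hω : IsSymplecticAction H ω) {g : H} (hg : g ≠ 1) (hg5 : g ^ 5 = 1)
    {u : V} (hu : u ≠ 0) (hgu : g • u = u) {A : AddSubgroup V} (huA : u ∈ A)
    (hA : A ≤ perp ω u) (hgA : ∀ a ∈ A, g • a ∈ A) :
    (∀ a ∈ A, ∃ c : ZMod 3, a = c • u) ∨ A = perp ω u := by
  have : Finite V := hω.finite
  have : Fact (Nat.Prime 5) := ⟨by norm_num⟩
  have h := hω.card_modEq_card_inf_fixed hg5 A hgA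
  have h3 : Nat.card (A ⊓ fixed V g : AddSubgroup V) = 3 := by
    refine le_antisymm ?_ ?_
    · rw [← hω.card_perp_inf_fixed hg hg5 hu hgu]
      exact AddSubgroup.card_le_of_le (inf_le_inf_right _ hA)
    · have h1 : AddSubgroup.zmultiples u ≤ A ⊓ fixed V g := by
        simpa using ⟨huA, hgu⟩
      have h3 : addOrderOf u = 3 :=
        addOrderOf_eq_prime (by simpa using (ZModModule.char_nsmul_eq_zero 3 u)) hu
      rw [← h3, ← Nat.card_zmultiples]
      exact AddSubgroup.card_le_of_le h1
  rw [h3] at h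
  obtain ⟨d, hd, hc⟩ := hω.card_addSubgroup A
  rw [hc] at h
  have h15 : d = 1 ∨ d = 5 := by
    revert h
    interval_cases d <;> decide
  rcases h15 with rfl | rfl
  · exact Or.inl fun a ha => hω.exists_smul_of_card hu huA hc ha
  · exact Or.inr (AddSubgroup.eq_of_le_of_card_ge hA (by rw [hc, hω.card_perp hu]))

theorem eq_smul_of_isotropic (hω : IsSymplecticAction H ω) {g : H} (hg : g ≠ 1) (hg5 : g ^ 5 = 1)
    {u : V} (hu : u ≠ 0) (hgu : g • u = u) {A : AddSubgroup V} (huA : u ∈ A)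
    (hA : ∀ a ∈ A, ∀ b ∈ A, ω a b = 0) (hgA : ∀ a ∈ A, g • a ∈ A) {a : V} (ha : a ∈ A) :
    ∃ c : ZMod 3, a = c • u := by
  have : Finite V := hω.finite
  rcases hω.line_or_eq_perp hg hg5 hu hgu huA (fun a ha => hA u huA a ha) hgA with h | h
  · exact h a ha
  exfalso
  obtain ⟨y, hy⟩ := hω.exists_ne_zero hu
  have hinj : Function.Injective (fun w : A => ω w y) := by
    intro w w' hww
    refine Subtype.ext (sub_eq_zero.1 (hω.nondeg _ fun v => ?_))
    set c := ω u v / ω u y with hc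
    have hv : v - c • y ∈ A := by
      rw [h, mem_perp]
      simp [hc, hy]
    have h1 := hA _ (A.sub_mem w.2 w'.2) _ hv
    have h2 : ω (w - w' : V) y = 0 := by
      simpa [sub_eq_zero] using hww
    rw [map_sub, map_smul, h2] at h1
    simpa using h1
  have := Nat.card_le_card_of_injective _ hinj
  rw [h, hω.card_perp hu, Nat.card_zmod] at this
  omega

theorem exists_perp_not_line (hω : IsSymplecticAction H ω) {u : V} (hu : u ≠ 0) :
    ¬ ∀ w, ω u w = 0 → ∃ c : ZMod 3, w = c • u := by
  intro h
  have := hω.card_of_le_line (A := perp ω u) h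
  rw [hω.card_perp hu] at this
  omega

theorem eq_one_of_forall_perp (hω : IsSymplecticAction H ω) {u : V} (hu : u ≠ 0)
    (hfix : ∀ h : H, h • u = u)
    (hNT : ∀ h : H, (∀ w, ω u w = 0 → h • w = w) → h = 1) {g : H} (hg : g ≠ 1)
    (hg5 : g ^ 5 = 1) {h : H} (hh : ∀ w, ω u w = 0 → ∃ c : ZMod 3, h • w = w + c • u) : h = 1 := by
  have hperp (k : H) (w : V) : ω u (k • w) = ω u w := by
    conv_lhs => rw [← hfix k]
    exact hω.inv _ _ _
  let A : AddSubgroup V :=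
    { carrier := {w | ω u w = 0 ∧ ∀ k : H,
        (∀ w, ω u w = 0 → ∃ c : ZMod 3, k • w = w + c • u) → k • w = w}
      add_mem' := fun ⟨ha, ha'⟩ ⟨hb, hb'⟩ =>
        ⟨by rw [map_add, ha, hb, add_zero], fun k hk => by rw [smul_add, ha' k hk, hb' k hk]⟩
      zero_mem' := ⟨map_zero _, fun k _ => smul_zero k⟩
      neg_mem' := fun ⟨ha, ha'⟩ =>
        ⟨by rw [map_neg, ha, neg_zero], fun k hk => by rw [smul_neg, ha' k hk]⟩ }
  have hgA : ∀ a ∈ A, g • a ∈ A := by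
    rintro a ⟨ha, ha'⟩
    refine ⟨(hperp _ _).trans ha, fun k hk => ?_⟩
    have h1 := ha' (g⁻¹ * k * g) fun w hw => by
      obtain ⟨c, hc⟩ := hk (g • w) ((hperp _ _).trans hw)
      refine ⟨c, ?_⟩
      rw [mul_smul, mul_smul, hc, smul_add, inv_smul_smul, smul_zmod_smul, hfix]
    rw [mul_smul, mul_smul, inv_smul_eq_iff] at h1
    exact h1
  have huA : u ∈ A := ⟨hω.alt u, fun k _ => hfix k⟩
  rcases hω.line_or_eq_perp hg hg5 hu (hfix g) huA (fun a ha => ha.1) hgA with hA | hA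
  swap
  · refine hNT h fun w hw => ?_
    have : w ∈ A := hA ▸ (mem_perp.2 hw)
    exact this.2 h hh
  obtain ⟨y, hy⟩ := hω.exists_ne_zero hu
  have hyu : ω y u ≠ 0 := by rw [hω.skew]; simpa using hy
  have hap (k : H) : ω u (k • y - y) = 0 := by rw [map_sub, hperp, sub_self]
  have key (k : H) (w : V) (c : ZMod 3) (hw : ω u w = 0) (hc : k • w = w + c • u) :
      ω (k • y - y) w = - c * ω y u := by
    have h1 := hω.inv k y w
    have h2 : ω (k • y - y) u = 0 := by rw [hω.skew, hap, neg_zero]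
    rw [hc, show k • y = (k • y - y) + y by abel] at h1
    simp only [map_add, map_smul, LinearMap.add_apply, smul_eq_mul, h2] at h1
    linear_combination h1
  have hA' : h • y - y ∈ A := by
    refine ⟨hap h, fun k hk => ?_⟩
    obtain ⟨c, hc⟩ := hk _ (hap h)
    obtain ⟨d, hd⟩ := hh _ (hap k)
    have hcomm : h * k = k * h := by
      refine mul_inv_eq_one.1 (hNT (h * k * (k * h)⁻¹) fun w hw => ?_)
      obtain ⟨w', rfl⟩ : ∃ w', (k * h) • w' = w := ⟨(k * h)⁻¹ • w, smul_inv_smul _ _⟩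
      rw [mul_smul, inv_smul_smul]
      rw [hperp] at hw
      obtain ⟨a, ha⟩ := hk w' hw
      obtain ⟨b, hb⟩ := hh w' hw
      rw [mul_smul, mul_smul, ha, hb, smul_add, smul_add, ha, hb, smul_zmod_smul, smul_zmod_smul,
        hfix, hfix]
      abel
    have hcd : c = d := by
      have h1 : h • (k • y) = k • (h • y) := by rw [← mul_smul, hcomm, mul_smul]
      rw [smul_sub] at hc hd
      have h2 : (c - d) • u = 0 := by
        have e1 : c • u = k • h • y - k • y - (h • y - y) := by rw [hc]; abel
        have e2 : d • u = h • k • y - h • y - (k • y - y) := by rw [hd]; abel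
        rw [sub_smul, e1, e2, h1]
        abel
      exact sub_eq_zero.1 ((smul_eq_zero.1 h2).resolve_right hu)
    have h1 := key k _ c (hap h) hc
    have h2 := key h _ d (hap k) hd
    rw [hω.skew, h1, hcd] at h2
    have h3 : d * ω y u = 0 := by
      have : (2 : ZMod 3) * (d * ω y u) = 0 := by linear_combination h2
      exact (mul_eq_zero.1 this).resolve_left (by decide)
    have hd0 : d = 0 := (mul_eq_zero.1 h3).resolve_right hyu
    rw [hc, hcd, hd0, zero_smul, add_zero]
  obtain ⟨e, he⟩ := hA _ hA'
  refine hNT h fun w hw => ?_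
  obtain ⟨c, hc⟩ := hh w hw
  have h1 := key h w c hw hc
  rw [he, map_smul, LinearMap.smul_apply, hw, smul_zero] at h1
  have hc0 : c = 0 := by
    rcases mul_eq_zero.1 h1.symm with h2 | h2
    · exact neg_eq_zero.1 h2
    · exact absurd h2 hyu
  rw [hc, hc0, zero_smul, add_zero]

theorem eq_bot_of_isPGroup_three (hω : IsSymplecticAction H ω) {u : V} (hu : u ≠ 0)
    (hfix : ∀ h : H, h • u = u)
    (hNT : ∀ h : H, (∀ w, ω u w = 0 → h • w = w) → h = 1) {g : H} (hg : g ≠ 1)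
    (hg5 : g ^ 5 = 1) {Q : Subgroup H} (hQ : IsPGroup 3 Q)
    (hgQ : g ∈ Subgroup.normalizer (Q : Set H)) : Q = ⊥ := by
  have : Finite V := hω.finite
  have hperp (k : H) (w : V) : ω u (k • w) = ω u w := by
    conv_lhs => rw [← hfix k]
    exact hω.inv _ _ _
  let A : AddSubgroup V :=
    { carrier := {w | ω u w = 0 ∧ ∀ k ∈ Q, ∃ c : ZMod 3, k • w = w + c • u}
      add_mem' := by
        rintro a b ⟨ha, ha'⟩ ⟨hb, hb'⟩
        refine ⟨by rw [map_add, ha, hb, add_zero], fun k hk => ?_⟩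
        obtain ⟨c, hc⟩ := ha' k hk
        obtain ⟨d, hd⟩ := hb' k hk
        exact ⟨c + d, by rw [smul_add, hc, hd, add_smul]; abel⟩
      zero_mem' := ⟨map_zero _, fun k _ => ⟨0, by simp⟩⟩
      neg_mem' := by
        rintro a ⟨ha, ha'⟩
        refine ⟨by rw [map_neg, ha, neg_zero], fun k hk => ?_⟩
        obtain ⟨c, hc⟩ := ha' k hk
        exact ⟨-c, by rw [smul_neg, hc, neg_smul]; abel⟩ }
  have hgA : ∀ a ∈ A, g • a ∈ A := by
    rintro a ⟨ha, ha'⟩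
    refine ⟨(hperp _ _).trans ha, fun k hk => ?_⟩
    obtain ⟨c, hc⟩ := ha' (g⁻¹ * k * g) ((Subgroup.mem_normalizer_iff''.1 hgQ _).1 hk)
    refine ⟨c, ?_⟩
    rw [mul_smul, mul_smul, inv_smul_eq_iff, smul_add, smul_zmod_smul, hfix] at hc
    exact hc
  have huA : u ∈ A := ⟨hω.alt u, fun k _ => ⟨0, by simp [hfix]⟩⟩
  rcases hω.line_or_eq_perp hg hg5 hu (hfix g) huA (fun a ha => ha.1) hgA with hA | hA
  swap
  · refine (Subgroup.eq_bot_iff_forall Q).2 fun q hq => ?_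
    refine hω.eq_one_of_forall_perp hu hfix hNT hg hg5 fun w hw => ?_
    have : w ∈ A := hA ▸ (mem_perp.2 hw)
    exact this.2 q hq
  exfalso
  have : Fact (Nat.Prime 3) := ⟨Nat.prime_three⟩
  let Z := AddSubgroup.zmultiples u
  have hZ (v : V) : v ∈ Z ↔ ∃ c : ZMod 3, v = c • u := by
    rw [AddSubgroup.mem_zmultiples_iff]
    constructor
    · rintro ⟨k, rfl⟩
      exact ⟨k, (Int.cast_smul_eq_zsmul _ _ _).symm⟩
    · rintro ⟨c, rfl⟩
      exact ⟨c.val, by rw [natCast_zsmul, ← Nat.cast_smul_eq_nsmul (ZMod 3), ZMod.natCast_zmod_val]⟩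
  have hle (h : H) : Z ≤ Z.comap (DistribSMul.toAddMonoidHom V h) := by
    intro v hv
    obtain ⟨c, rfl⟩ := (hZ v).1 hv
    exact (hZ _).2 ⟨c, by simp [smul_zmod_smul, hfix]⟩
  let _ : MulAction H (V ⧸ Z) :=
    { smul := fun h => QuotientAddGroup.map Z Z (DistribSMul.toAddMonoidHom V h) (hle h)
      one_smul := fun x => by
        obtain ⟨v, rfl⟩ := QuotientAddGroup.mk_surjective x
        exact congrArg _ (one_smul H v)
      mul_smul := fun h k x => by
        obtain ⟨v, rfl⟩ := QuotientAddGroup.mk_surjective x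
        exact congrArg _ (mul_smul h k v) }
  have hmk (h : H) (v : V) : h • (v : V ⧸ Z) = ((h • v : V) : V ⧸ Z) := rfl
  let S : AddSubgroup (V ⧸ Z) := (perp ω u).map (QuotientAddGroup.mk' Z)
  have hcard := hQ.card_modEq_card_fixed (S : Set (V ⧸ Z)) (by
    rintro h hh _ ⟨w, hw, rfl⟩
    exact ⟨h • w, (hperp h w).trans hw, rfl⟩)
  have hone : {s : V ⧸ Z | s ∈ (S : Set (V ⧸ Z)) ∧ ∀ h ∈ Q, h • s = s} = {0} := by
    ext s
    constructor
    · rintro ⟨⟨w, hw, rfl⟩, hs⟩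
      have hwA : w ∈ A := by
        refine ⟨hw, fun k hk => ?_⟩
        have h1 := hs k hk
        simp only [QuotientAddGroup.mk'_apply, hmk] at h1
        obtain ⟨c, hc⟩ := (hZ _).1 (QuotientAddGroup.eq.1 h1.symm)
        exact ⟨c, by rw [← hc]; abel⟩
      exact (QuotientAddGroup.eq_zero_iff w).2 ((hZ w).2 (hA w hwA))
    · rintro rfl
      exact ⟨S.zero_mem, fun h _ => by
        change h • ((0 : V) : V ⧸ Z) = _
        rw [hmk, smul_zero]
        rfl⟩
  have h1 : Nat.card ({0} : Set (V ⧸ Z)) = 1 := Nat.card_unique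
  rw [hone, h1] at hcard
  have hdvd : Nat.card S ∣ 3 ^ 6 := by
    refine S.card_addSubgroup_dvd_card.trans ?_
    rw [← hω.card]
    exact Z.card_quotient_dvd_card
  obtain ⟨d, hd, hc⟩ := (Nat.dvd_prime_pow Nat.prime_three).1 hdvd
  change Nat.card S ≡ 1 [MOD 3] at hcard
  rw [hc] at hcard
  have hd0 : d = 0 := by
    revert hcard
    interval_cases d <;> decide
  rw [hd0, pow_zero, AddSubgroup.card_eq_one] at hc
  refine hω.exists_perp_not_line hu fun w hw => ?_
  have h1 : (QuotientAddGroup.mk' Z w) ∈ S := ⟨w, hw, rfl⟩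
  rw [hc, AddSubgroup.mem_bot] at h1
  exact (hZ w).1 ((QuotientAddGroup.eq_zero_iff w).1 h1)

theorem involution_smul (hω : IsSymplecticAction H ω) {u : V} (hu : u ≠ 0)
    (hfix : ∀ h : H, h • u = u)
    (hNT : ∀ h : H, (∀ w, ω u w = 0 → h • w = w) → h = 1) {g t : H} (hg : g ≠ 1)
    (hg5 : g ^ 5 = 1) (ht : t ≠ 1) (ht2 : t * t = 1)
    (htg : t * g * t⁻¹ = g ∨ t * g * t⁻¹ = g⁻¹) {w : V} (hw : ω u w = 0) :
    ∃ c : ZMod 3, t • w = - w + c • u := by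
  have hperp (k : H) (w : V) : ω u (k • w) = ω u w := by
    conv_lhs => rw [← hfix k]
    exact hω.inv _ _ _
  have htt (v : V) : t • t • v = v := by rw [← mul_smul, ht2, one_smul]
  rcases htg with htg | htg
  · have hcomm (v : V) : t • g • v = g • t • v := by
      rw [← mul_smul, ← mul_smul, mul_inv_eq_iff_eq_mul.1 htg]
    let A : AddSubgroup V :=
      { carrier := {w | ω u w = 0 ∧ ∃ c : ZMod 3, t • w = w + c • u}
        add_mem' := by
          rintro a b ⟨ha, c, hc⟩ ⟨hb, d, hd⟩
          exact ⟨by rw [map_add, ha, hb, add_zero],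
            c + d, by rw [smul_add, hc, hd, add_smul]; abel⟩
        zero_mem' := ⟨map_zero _, 0, by simp⟩
        neg_mem' := by
          rintro a ⟨ha, c, hc⟩
          exact ⟨by rw [map_neg, ha, neg_zero], -c, by rw [smul_neg, hc, neg_smul]; abel⟩ }
    have hgA : ∀ a ∈ A, g • a ∈ A := by
      rintro a ⟨ha, c, hc⟩
      exact ⟨(hperp _ _).trans ha, c, by rw [hcomm, hc, smul_add, smul_zmod_smul, hfix]⟩
    have huA : u ∈ A := ⟨hω.alt u, 0, by simp [hfix]⟩
    rcases hω.line_or_eq_perp hg hg5 hu (hfix g) huA (fun a ha => ha.1) hgA with hA | hA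
    · obtain ⟨c, hc⟩ := hA (t • w + w)
        ⟨by rw [map_add, hperp, hw, add_zero], 0, by rw [smul_add, htt]; simp [add_comm]⟩
      exact ⟨c, by rw [← hc]; abel⟩
    · refine absurd (hω.eq_one_of_forall_perp hu hfix hNT hg hg5 fun w hw => ?_) ht
      have : w ∈ A := hA ▸ (mem_perp.2 hw)
      exact this.2
  · exfalso
    have hinvert (k : H) (hk : k ∈ Subgroup.zpowers g) : t * k * t⁻¹ = k⁻¹ := by
      obtain ⟨n, rfl⟩ := hk
      simp only
      rw [← conj_zpow, htg, _root_.inv_zpow]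
    have hline (w : V) (hw : ω u w = 0) (htw : t • w = w ∨ t • w = - w) :
        ∃ c : ZMod 3, w = c • u := by
      have hiso (k : H) (hk : k ∈ Subgroup.zpowers g) : ω (k • w) w = 0 := by
        have h1 : ω (k • w) w = ω (k⁻¹ • t • w) (t • w) := by
          rw [← hω.inv t, ← mul_smul t, ← mul_smul, mul_inv_eq_iff_eq_mul.1 (hinvert k hk)]
        have h2 : ω (k⁻¹ • t • w) (t • w) = ω (k⁻¹ • w) w := by
          rcases htw with h | h <;> simp [h]
        have h3 : ω (k⁻¹ • w) w = - ω (k • w) w := by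
          rw [← hω.inv k, smul_inv_smul, hω.skew]
        have h4 : (2 : ZMod 3) * ω (k • w) w = 0 := by linear_combination h1 + h2 + h3
        exact (mul_eq_zero.1 h4).resolve_left (by decide)
      let s : Set V := insert u {v | ∃ k ∈ Subgroup.zpowers g, v = k • w}
      refine hω.eq_smul_of_isotropic (A := AddSubgroup.closure s) hg hg5 hu (hfix g)
        (AddSubgroup.subset_closure (Set.mem_insert _ _)) ?_ ?_
        (AddSubgroup.subset_closure (Set.mem_insert_of_mem _ ⟨1, one_mem _, (one_smul _ _).symm⟩))
      · intro a ha b hb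
        induction ha, hb using AddSubgroup.closure_induction₂ with
        | mem x y hx hy =>
          rcases hx with rfl | ⟨k, hk, rfl⟩ <;> rcases hy with rfl | ⟨l, hl, rfl⟩
          · exact hω.alt _
          · rw [hperp, hw]
          · rw [hω.skew, hperp, hw, neg_zero]
          · rw [← hω.inv l⁻¹, inv_smul_smul, ← mul_smul]
            exact hiso _ (mul_mem (inv_mem hl) hk)
        | zero_left => simp
        | zero_right => simp
        | add_left x y z _ _ _ h1 h2 => rw [map_add, LinearMap.add_apply, h1, h2, add_zero]
        | add_right x y z _ _ _ h1 h2 => rw [map_add, h1, h2, add_zero]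
        | neg_left x y _ _ h1 => rw [map_neg, LinearMap.neg_apply, h1, neg_zero]
        | neg_right x y _ _ h1 => rw [map_neg, h1, neg_zero]
      · intro a ha
        induction ha using AddSubgroup.closure_induction with
        | mem x hx =>
          refine AddSubgroup.subset_closure ?_
          rcases hx with rfl | ⟨k, hk, rfl⟩
          · rw [hfix]
            exact Set.mem_insert _ _
          · exact Set.mem_insert_of_mem _
              ⟨g * k, mul_mem (Subgroup.mem_zpowers g) hk, by rw [mul_smul]⟩
        | zero => simp
        | add x y _ _ h1 h2 => rw [smul_add]; exact add_mem h1 h2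
        | neg x _ h1 => rw [smul_neg]; exact neg_mem h1
    refine hω.exists_perp_not_line hu fun w hw => ?_
    obtain ⟨a, ha⟩ := hline (t • w + w) (by rw [map_add, hperp, hw, add_zero])
      (Or.inl (by rw [smul_add, htt, add_comm]))
    obtain ⟨b, hb⟩ := hline (t • w - w) (by rw [map_sub, hperp, hw, sub_zero])
      (Or.inr (by rw [smul_sub, htt]; abel))
    refine ⟨b - a, ?_⟩
    have h3 : (3 : ℕ) • w = 0 := ZModModule.char_nsmul_eq_zero 3 w
    rw [sub_smul, ← ha, ← hb]
    rw [show t • w - w - (t • w + w) = w - 3 • w by abel, h3, sub_zero]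

end IsSymplecticAction

section SylowFive

variable {H : Type*} [Group H] [Finite H]

/-- If `p` divides the index of a normal subgroup `N`, then the normalizer of a Sylow subgroup of
`N` has an element of order `p`. -/
theorem Sylow.exists_orderOf_eq_mem_normalizer {p q : ℕ} [Fact p.Prime] [Fact q.Prime]
    {N : Subgroup H} [N.Normal] (P : Sylow q N) (h : p ∣ N.index) :
    ∃ m ∈ Subgroup.normalizer ((P : Subgroup N).map N.subtype : Set H), orderOf m = p := by
  have h1 := P.normalizer_sup_eq_top
  have h2 : p ∣ Nat.card (Subgroup.normalizer ((P : Subgroup N).map N.subtype : Set H)) := by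
    rw [← Subgroup.relIndex_top_right, ← h1, Subgroup.relIndex_sup_right] at h
    exact h.trans (Subgroup.relIndex_dvd_card _ _)
  obtain ⟨m, hm⟩ := exists_prime_orderOf_dvd_card' p h2
  exact ⟨m, m.2, by rw [← hm, Subgroup.orderOf_coe]⟩

theorem Sylow.exists_zpowers_eq (h5 : 5 ∣ Nat.card H) (h25 : ¬ 25 ∣ Nat.card H)
    (P : Sylow 5 H) : ∃ g : H, orderOf g = 5 ∧ Subgroup.zpowers g = P := by
  have : Fact (Nat.Prime 5) := ⟨by norm_num⟩
  obtain ⟨n, hn⟩ := IsPGroup.iff_card.1 P.2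
  have h1 := P.dvd_card_of_dvd_card h5
  have hn1 : n = 1 := by
    rcases n with _ | _ | n
    · rw [hn] at h1
      norm_num at h1
    · rfl
    · refine absurd ((Dvd.intro_left (5 ^ n) ?_).trans (P : Subgroup H).card_subgroup_dvd_card) h25
      rw [hn]
      ring
  rw [hn1, pow_one] at hn
  obtain ⟨g, hg⟩ := exists_prime_orderOf_dvd_card' 5 h1
  have hg' : orderOf (g : H) = 5 := (Subgroup.orderOf_coe g).trans hg
  refine ⟨g, hg', Subgroup.eq_of_le_of_card_ge (by simp) ?_⟩
  rw [hn, Nat.card_zpowers, hg']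

theorem exists_conj_eq_pow {g y : H} (hy : y ∈ Subgroup.normalizer (Subgroup.zpowers g : Set H)) :
    ∃ k : ℕ, y * g * y⁻¹ = g ^ k := by
  have h1 := (Subgroup.mem_normalizer_iff.1 hy g).1 (Subgroup.mem_zpowers g)
  obtain ⟨k, hk⟩ := (isOfFinOrder_of_finite g).mem_powers_iff_mem_zpowers.2 h1
  exact ⟨k, hk.symm⟩

theorem conj_pow_eq_pow {G : Type*} [Group G] {g y : G} {k : ℕ} (h : y * g * y⁻¹ = g ^ k) (n : ℕ) :
    y ^ n * g * (y ^ n)⁻¹ = g ^ k ^ n := by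
  induction n with
  | zero => simp
  | succ n ih =>
    calc y ^ (n + 1) * g * (y ^ (n + 1))⁻¹ = y * (y ^ n * g * (y ^ n)⁻¹) * y⁻¹ := by group
      _ = (y * g * y⁻¹) ^ k ^ n := by rw [ih, conj_pow]
      _ = _ := by rw [h, ← pow_mul, pow_succ']

theorem commute_pow_four {g y : H} (hg : orderOf g = 5)
    (hy : y ∈ Subgroup.normalizer (Subgroup.zpowers g : Set H)) : Commute (y ^ 4) g := by
  obtain ⟨k, hk⟩ := exists_conj_eq_pow hy
  have h4 := conj_pow_eq_pow hk 4
  have hk5 : k ^ 4 ≡ 1 [MOD 5] := by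
    have : k % 5 ≠ 0 := by
      intro h0
      obtain ⟨l, rfl⟩ := Nat.dvd_of_mod_eq_zero h0
      rw [pow_mul, ← hg, pow_orderOf_eq_one, one_pow, mul_inv_eq_one, mul_eq_left] at hk
      rw [hk, orderOf_one] at hg
      omega
    have h : k % 5 < 5 := Nat.mod_lt _ (by norm_num)
    rw [Nat.ModEq, Nat.pow_mod]
    interval_cases k % 5 <;> simp_all
  rw [← hg] at hk5
  rw [pow_eq_pow_iff_modEq.2 hk5, pow_one] at h4
  exact mul_inv_eq_iff_eq_mul.1 h4

theorem conj_eq_or_eq_inv {g t : H} (hg : orderOf g = 5) (ht : t * t = 1)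
    (hy : t ∈ Subgroup.normalizer (Subgroup.zpowers g : Set H)) :
    t * g * t⁻¹ = g ∨ t * g * t⁻¹ = g⁻¹ := by
  obtain ⟨k, hk⟩ := exists_conj_eq_pow hy
  have h2 := conj_pow_eq_pow hk 2
  rw [pow_two, ht, one_mul, inv_one, mul_one] at h2
  have h3 : 1 ≡ k ^ 2 [MOD 5] := by
    rw [← hg]
    exact pow_eq_pow_iff_modEq.1 (by rw [pow_one]; exact h2)
  have h4 : k ≡ 1 [MOD 5] ∨ k ≡ 4 [MOD 5] := by
    rw [Nat.ModEq, Nat.pow_mod] at h3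
    simp only [Nat.ModEq]
    have h : k % 5 < 5 := Nat.mod_lt _ (by norm_num)
    revert h3
    generalize k % 5 = r at h
    interval_cases r <;> decide
  rw [hk]
  rcases h4 with h | h
  · left
    rw [← hg] at h
    rw [pow_eq_pow_iff_modEq.2 h, pow_one]
  · right
    rw [← hg] at h
    rw [pow_eq_pow_iff_modEq.2 h, eq_inv_iff_mul_eq_one, ← pow_succ]
    have h1 := pow_orderOf_eq_one g
    rwa [hg] at h1

end SylowFive

namespace IsSymplecticAction

variable {H V : Type*} [Group H] [AddCommGroup V] [Module (ZMod 3) V] [DistribMulAction H V]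
  {ω : LinearMap.BilinForm (ZMod 3) V}

theorem exists_neg_one (hω : IsSymplecticAction H ω) [Finite H] {u : V} (hu : u ≠ 0)
    (hfix : ∀ h : H, h • u = u)
    (hNT : ∀ h : H, (∀ w, ω u w = 0 → h • w = w) → h = 1) (h3 : 3 ∣ Nat.card H)
    (h5 : 5 ∣ Nat.card H) (h25 : ¬ 25 ∣ Nat.card H) :
    ∃ z : H, z * z = 1 ∧ ∀ w, ω u w = 0 → ∃ c : ZMod 3, z • w = - w + c • u := by
  have : Fact (Nat.Prime 5) := ⟨by norm_num⟩
  have : Fact (Nat.Prime 3) := ⟨by norm_num⟩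
  have : Fact (Nat.Prime 2) := ⟨by norm_num⟩
  let P : Sylow 5 H := default
  obtain ⟨g, hg, hgP⟩ := P.exists_zpowers_eq h5 h25
  have ne_one {a : H} (ha : orderOf a = 5) : a ≠ 1 := by
    rintro rfl
    rw [orderOf_one] at ha
    omega
  by_cases h2 : 2 ∣ Nat.card (Subgroup.normalizer (Subgroup.zpowers g : Set H))
  · obtain ⟨t, ht⟩ := exists_prime_orderOf_dvd_card' 2 h2
    have ht' : orderOf (t : H) = 2 := by rw [← ht, Subgroup.orderOf_coe]
    have htt : (t : H) * t = 1 := by rw [← pow_two, ← ht', pow_orderOf_eq_one]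
    refine ⟨t, htt, fun w hw => ?_⟩
    refine hω.involution_smul hu hfix hNT (ne_one hg) (hg ▸ pow_orderOf_eq_one g) ?_ htt
      (conj_eq_or_eq_inv hg htt t.2) hw
    rintro h
    rw [h, orderOf_one] at ht'
    omega
  exfalso
  have hP : Subgroup.normalizer (P : Set H) ≤ Subgroup.centralizer (P : Set H) := by
    have hPg : (P : Set H) = (Subgroup.zpowers g : Set H) := by rw [hgP]; rfl
    rw [hPg]
    intro y hy
    rw [Subgroup.mem_centralizer_iff]
    have hodd : ¬ 2 ∣ orderOf y := fun h => h2 (h.trans (by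
      have := orderOf_dvd_natCard (⟨y, hy⟩ : Subgroup.normalizer (Subgroup.zpowers g : Set H))
      rwa [← Subgroup.orderOf_coe] at this))
    have hcop : (4 : ℕ).Coprime (orderOf y) :=
      Nat.Coprime.pow_left 2 ((Nat.prime_two.coprime_iff_not_dvd).2 hodd)
    obtain ⟨m, hm⟩ := exists_pow_eq_self_of_coprime hcop
    have hcomm : Commute y g := by
      rw [← hm]
      exact (commute_pow_four hg hy).pow_left m
    rintro _ ⟨n, rfl⟩
    exact (hcomm.zpow_right n).eq.symm
  have hcompl := MonoidHom.ker_transferSylow_isComplement' P hP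
  set K := (MonoidHom.transferSylow P hP).ker with hK
  have hcardP : Nat.card P = 5 := by
    rw [← hgP, Nat.card_zpowers, hg]
  have hidx : K.index = 5 := hcompl.symm.index_eq_card.trans hcardP
  have h3K : 3 ∣ Nat.card K := by
    have := hcompl.card_mul_card
    rw [← this] at h3
    refine (Nat.Coprime.dvd_mul_right ?_).1 h3
    rw [hcardP]
    norm_num
  let Q : Sylow 3 K := default
  obtain ⟨m, hm, hm5⟩ := Q.exists_orderOf_eq_mem_normalizer (p := 5) (by rw [hidx])
  have hQ := hω.eq_bot_of_isPGroup_three hu hfix hNT (ne_one hm5) (hm5 ▸ pow_orderOf_eq_one m)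
    (Q.2.map K.subtype) hm
  rw [Subgroup.map_eq_bot_iff_of_injective _ K.subtype_injective] at hQ
  exact Q.ne_bot_of_dvd_card h3K hQ

/-- A group fixing the vector `u` contains a transvection with centre `u` if it has an element of
order five and if `u = x • w₀ - w₀` for some element `x` of order three. -/
theorem false_of_forall_smul_eq (hω : IsSymplecticAction H ω) [Finite H] {u : V} (hu : u ≠ 0)
    (hfix : ∀ h : H, h • u = u)
    (hNT : ∀ h : H, (∀ w, ω u w = 0 → h • w = w) → h = 1)
    (h5 : 5 ∣ Nat.card H) (h25 : ¬ 25 ∣ Nat.card H) {x : H} (hx : x ^ 3 = 1) {w₀ : V}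
    (hw₀ : x • w₀ = w₀ + u) : False := by
  have : Fact (Nat.Prime 5) := ⟨by norm_num⟩
  have : Fact (Nat.Prime 3) := ⟨by norm_num⟩
  have hperp (k : H) (w : V) : ω u (k • w) = ω u w := by
    conv_lhs => rw [← hfix k]
    exact hω.inv _ _ _
  have hx1 : x ≠ 1 := by
    rintro rfl
    simp [hu] at hw₀
  have h3 : 3 ∣ Nat.card H := orderOf_eq_prime hx hx1 ▸ orderOf_dvd_natCard x
  obtain ⟨z, hzz, hz⟩ := hω.exists_neg_one hu hfix hNT h3 h5 h25
  have ne_one {a : H} (ha : orderOf a = 5) : a ≠ 1 := by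
    rintro rfl
    rw [orderOf_one] at ha
    omega
  obtain ⟨g₀, hg₀⟩ := exists_prime_orderOf_dvd_card' 5 h5
  have hcomm (h : H) : z * h = h * z := by
    refine mul_inv_eq_one.1 (hω.eq_one_of_forall_perp hu hfix hNT (ne_one hg₀)
      (hg₀ ▸ pow_orderOf_eq_one g₀) (h := z * h * (h * z)⁻¹) fun w hw => ?_)
    obtain ⟨w', rfl⟩ : ∃ w', (h * z) • w' = w := ⟨(h * z)⁻¹ • w, smul_inv_smul _ _⟩
    rw [mul_smul _ (h * z)⁻¹, inv_smul_smul]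
    rw [hperp] at hw
    obtain ⟨c, hc⟩ := hz w' hw
    obtain ⟨d, hd⟩ := hz (h • w') ((hperp _ _).trans hw)
    refine ⟨d - c, ?_⟩
    rw [mul_smul, mul_smul, hc, hd, smul_add, smul_neg, smul_zmod_smul, hfix, sub_smul]
    abel
  obtain ⟨y, hy⟩ := hω.exists_ne_zero hu
  set f := y + z • y with hf
  have hzf : z • f = f := by rw [hf, smul_add, ← mul_smul, hzz, one_smul, add_comm]
  have huf : ω u f ≠ 0 := by
    rw [hf, map_add, hperp, ← two_mul]
    exact mul_ne_zero (by decide +revert) hy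
  have hμ (h : H) : ∃ c : ZMod 3, h • f = f + c • u := by
    obtain ⟨c, hc⟩ := hz (h • f - f) (by rw [map_sub, hperp, sub_self])
    refine ⟨-c, ?_⟩
    rw [smul_sub, ← mul_smul, hcomm, mul_smul, hzf] at hc
    have h3 : (3 : ℕ) • (h • f - f) = 0 := ZModModule.char_nsmul_eq_zero 3 _
    have e : c • u = (3 : ℕ) • (h • f - f) - (h • f - f) := by
      calc c • u = (-(h • f - f) + c • u) + (h • f - f) := by abel
        _ = (h • f - f) + (h • f - f) := by rw [← hc]
        _ = _ := by abel
    rw [neg_smul, e, h3]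
    abel
  choose μ hμ using hμ
  let φ : H →* Multiplicative (ZMod 3) := MonoidHom.mk' (fun h => Multiplicative.ofAdd (μ h)) (by
    intro h k
    rw [← ofAdd_add]
    congr 1
    have h1 : μ (h * k) • u = (μ h + μ k) • u := by
      have := hμ (h * k)
      rw [mul_smul, hμ k, smul_add, hμ h, smul_zmod_smul, hfix] at this
      rw [add_smul]
      exact (add_left_cancel (this.symm.trans (add_assoc _ _ _)))
    exact smul_left_injective _ hu h1)
  have hφx : φ x ≠ 1 := by
    intro h1
    have h1 : μ x = 0 := h1
    have h2 := hω.inv x f w₀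
    rw [hμ x, h1, zero_smul, add_zero, hw₀, map_add, add_eq_left, hω.skew, neg_eq_zero] at h2
    exact huf h2
  have hidx : 3 ∣ φ.ker.index := by
    rw [Subgroup.index_ker]
    have h1 : orderOf (φ x) = 3 := orderOf_eq_prime (by rw [← map_pow, hx, map_one]) hφx
    have h2 := orderOf_dvd_natCard (⟨φ x, x, rfl⟩ : φ.range)
    rwa [← Subgroup.orderOf_coe, h1] at h2
  have h5K : 5 ∣ Nat.card φ.ker := by
    have h1 := φ.ker.card_mul_index
    have h2 : φ.ker.index ∣ 3 := by
      rw [Subgroup.index_ker]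
      simpa using φ.range.card_subgroup_dvd_card
    rw [← h1] at h5
    exact (Nat.Coprime.dvd_mul_right (Nat.Coprime.coprime_dvd_right h2 (by norm_num))).1 h5
  have h25K : ¬ 25 ∣ Nat.card φ.ker := fun h => h25 (h.trans φ.ker.card_subgroup_dvd_card)
  let P : Sylow 5 φ.ker := default
  obtain ⟨g, hg, hgP⟩ := P.exists_zpowers_eq h5K h25K
  obtain ⟨m, hm, hm3⟩ := P.exists_orderOf_eq_mem_normalizer hidx
  rw [← hgP, MonoidHom.map_zpowers] at hm
  have hg' : orderOf (g : H) = 5 := (Subgroup.orderOf_coe g).trans hg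
  have hc : Commute m (g : H) := by
    have h4 := commute_pow_four hg' hm
    rwa [pow_succ, show m ^ 3 = 1 from hm3 ▸ pow_orderOf_eq_one m, one_mul] at h4
  have hQ := hω.eq_bot_of_isPGroup_three hu hfix hNT (ne_one hg') (hg' ▸ pow_orderOf_eq_one (g : H))
    (Q := Subgroup.zpowers m) (IsPGroup.of_card (n := 1) (by rw [Nat.card_zpowers, hm3, pow_one])) (by
      refine Subgroup.centralizer_le_normalizer _ ?_
      rw [Subgroup.mem_centralizer_iff]
      rintro _ ⟨n, rfl⟩
      exact (hc.zpow_left n).eq)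
  rw [Subgroup.zpowers_eq_bot] at hQ
  rw [hQ, orderOf_one] at hm3
  omega

theorem ne_neg_self {v : V} (hv : v ≠ 0) : -v ≠ v := fun h => hv (by
  rw [neg_eq_iff_add_eq_zero] at h
  calc v = (3 : ℕ) • v - (v + v) := by abel
    _ = 0 := by rw [h, ZModModule.char_nsmul_eq_zero 3, sub_zero])

theorem dvd_card_of_fixed_eq_bot (hω : IsSymplecticAction H ω) {p : ℕ} [Fact p.Prime] {g : H}
    (hg : g ^ p = 1) (hfix : fixed V g = ⊥) {S : Set V} (hS : ∀ s ∈ S, g • s ∈ S)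
    (h0 : (0 : V) ∉ S) : p ∣ Nat.card S := by
  have := hω.finite
  have h := card_modEq_card_fixed_of_pow_eq_one hg S hS
  have he : {s | s ∈ S ∧ g • s = s} = ∅ := by
    refine Set.eq_empty_iff_forall_notMem.2 fun s ⟨hs, hgs⟩ => h0 ?_
    have : s ∈ fixed V g := hgs
    rw [hfix, AddSubgroup.mem_bot] at this
    exact this ▸ hs
  rw [he] at h
  simpa using (Nat.modEq_zero_iff_dvd.1 (by simpa using h))

theorem two_dvd_card (hω : IsSymplecticAction H ω) {S : Set V} (hS : ∀ s ∈ S, -s ∈ S)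
    (h0 : (0 : V) ∉ S) : 2 ∣ Nat.card S := by
  have := hω.finite
  have : Fact (Nat.Prime 2) := ⟨Nat.prime_two⟩
  have h := card_modEq_card_fixed_of_pow_eq_one (g := (-1 : ℤˣ)) (p := 2) (by simp) S
    (by simpa using hS)
  have he : {s | s ∈ S ∧ (-1 : ℤˣ) • s = s} = ∅ := by
    refine Set.eq_empty_iff_forall_notMem.2 fun s ⟨hs, hgs⟩ => ?_
    refine ne_neg_self (v := s) ?_ (by simpa using hgs)
    rintro rfl
    exact h0 hs
  rw [he] at h
  simpa using (Nat.modEq_zero_iff_dvd.1 (by simpa using h))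

theorem exists_sub_fixed (hω : IsSymplecticAction H ω) {x : H} (hx : x ^ 3 = 1) (hx1 : x ≠ 1) :
    ∃ w u : V, u ≠ 0 ∧ x • w = w + u ∧ x • u = u := by
  obtain ⟨w, hw⟩ : ∃ w : V, x • w ≠ w := by
    by_contra! h
    exact hx1 (hω.faithful x h)
  by_cases h : x • (x • w - w) = x • w - w
  · exact ⟨w, x • w - w, sub_ne_zero.2 hw, by abel, h⟩
  · refine ⟨x • w - w, x • (x • w - w) - (x • w - w), sub_ne_zero.2 h, by abel, ?_⟩
    have h3 : x • x • x • w = w := by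
      rw [← mul_smul, ← mul_smul, ← pow_two, ← pow_succ, hx, one_smul]
    simp only [smul_sub, h3]
    rw [← sub_eq_zero]
    calc _ = (3 : ℕ) • (x • w - x • x • w) := by abel
      _ = 0 := ZModModule.char_nsmul_eq_zero 3 _

theorem exists_transvection (hω : IsSymplecticAction H ω) [Finite H] (h3 : 3 ∣ Nat.card H)
    (h5 : 5 ∣ Nat.card H) (h7 : 7 ∣ Nat.card H) (h13 : 13 ∣ Nat.card H)
    (h25 : ¬ 25 ∣ Nat.card H) :
    ∃ (h : H) (u : V), h ≠ 1 ∧ u ≠ 0 ∧ ∀ w, ω u w = 0 → h • w = w := by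
  by_contra! hNT
  have : Finite V := hω.finite
  have : Fact (Nat.Prime 3) := ⟨by norm_num⟩
  have : Fact (Nat.Prime 5) := ⟨by norm_num⟩
  have : Fact (Nat.Prime 7) := ⟨by norm_num⟩
  have : Fact (Nat.Prime 13) := ⟨by norm_num⟩
  have spec (p : ℕ) [Fact p.Prime] (hp : p ∣ Nat.card H) : ∃ g : H, g ≠ 1 ∧ g ^ p = 1 := by
    obtain ⟨g, hg⟩ := exists_prime_orderOf_dvd_card' p hp
    refine ⟨g, ?_, hg ▸ pow_orderOf_eq_one g⟩
    rintro rfl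
    rw [orderOf_one] at hg
    exact (Fact.out : p.Prime).one_lt.ne hg
  obtain ⟨x, hx1, hx⟩ := spec 3 h3
  obtain ⟨a, ha1, ha⟩ := spec 5 h5
  obtain ⟨b, hb1, hb⟩ := spec 7 h7
  obtain ⟨c, hc1, hc⟩ := spec 13 h13
  obtain ⟨w₀, u, hu, hw₀, hxu⟩ := hω.exists_sub_fixed hx hx1
  let S : Set V := {v | ∃ h : H, v = h • u ∨ v = - (h • u)}
  have hS (k : H) : ∀ s ∈ S, k • s ∈ S := by
    rintro s ⟨h, rfl | rfl⟩
    · exact ⟨k * h, Or.inl (by rw [mul_smul])⟩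
    · exact ⟨k * h, Or.inr (by rw [mul_smul, smul_neg])⟩
  have hSneg : ∀ s ∈ S, -s ∈ S := by
    rintro s ⟨h, rfl | rfl⟩
    · exact ⟨h, Or.inr rfl⟩
    · exact ⟨h, Or.inl (neg_neg _)⟩
  have h0 : (0 : V) ∉ S := by
    rintro ⟨h, hh | hh⟩
    · exact hu ((smul_eq_zero_iff_eq h).1 hh.symm)
    · exact hu ((smul_eq_zero_iff_eq h).1 (neg_eq_zero.1 hh.symm))
  have hd2 := hω.two_dvd_card hSneg h0
  have hd7 := hω.dvd_card_of_fixed_eq_bot hb (hω.fixed_eq_bot_of_pow_seven hb1 hb) (hS b) h0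
  have hd13 := hω.dvd_card_of_fixed_eq_bot hc (hω.fixed_eq_bot_of_pow_thirteen hc1 hc) (hS c) h0
  have hlt : Nat.card S < 3 ^ 6 := by
    rw [← hω.card]
    exact Set.ncard_lt_card fun h => h0 (h ▸ Set.mem_univ 0)
  have hpos : 0 < Nat.card S := by
    have : Nonempty S := ⟨u, 1, Or.inl (one_smul _ _).symm⟩
    exact Nat.card_pos
  have hS5 : ¬ Nat.card S ≡ 0 [MOD 5] := by
    rw [Nat.ModEq]
    omega
  obtain ⟨v, ⟨h, hv⟩, hav⟩ : ∃ v ∈ S, a • v = v := by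
    by_contra! hcon
    have h := card_modEq_card_fixed_of_pow_eq_one ha S (hS a)
    have he : {s | s ∈ S ∧ a • s = s} = ∅ :=
      Set.eq_empty_iff_forall_notMem.2 fun s ⟨hs, hgs⟩ => hcon s hs hgs
    rw [he] at h
    exact hS5 (by simpa using h)
  have hah : a • h • u = h • u := by
    rcases hv with rfl | rfl
    · exact hav
    · simpa using hav
  let L := MulAction.stabilizer H u
  have hmem : h⁻¹ * a * h ∈ L := by
    rw [MulAction.mem_stabilizer_iff, mul_smul, mul_smul, hah, inv_smul_smul]
  have hL5 : 5 ∣ Nat.card L := by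
    have : orderOf (⟨_, hmem⟩ : L) = 5 := by
      refine orderOf_eq_prime (Subtype.ext ?_) fun h1 => ha1 ?_
      · have := conj_pow (i := 5) (a := h⁻¹) (b := a)
        rw [inv_inv] at this
        simp [this, ha]
      · have h2 : h⁻¹ * a * h = 1 := congrArg Subtype.val h1
        rwa [mul_eq_one_iff_eq_inv, mul_eq_left] at h2
    exact this ▸ orderOf_dvd_natCard _
  exact (hω.restrict L).false_of_forall_smul_eq hu (fun k => k.2)
    (fun k hk => by
      by_contra hk1
      obtain ⟨w, hw, hw'⟩ := hNT k u (by simpa using hk1) hu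
      exact hw' (hk w hw))
    hL5 (fun h => h25 (h.trans L.card_subgroup_dvd_card)) (x := ⟨x, hxu⟩) (Subtype.ext hx) hw₀

/-- The nonzero vectors `v` whose transvection `w ↦ w + ω v w • v` is induced by an element of
`H`. -/
def centers (H : Type*) [Group H] [DistribMulAction H V] (ω : LinearMap.BilinForm (ZMod 3) V) :
    Set V :=
  {v | v ≠ 0 ∧ ∃ h : H, ∀ w, h • w = w + ω v w • v}

theorem smul_mem_centers (hω : IsSymplecticAction H ω) (k : H) {v : V} (hv : v ∈ centers H ω) :
    k • v ∈ centers H ω := by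
  obtain ⟨h0, h, hh⟩ := hv
  refine ⟨(smul_ne_zero_iff_ne k).2 h0, k * h * k⁻¹, fun w => ?_⟩
  rw [mul_smul, mul_smul, hh, smul_add, smul_inv_smul, smul_zmod_smul, ← hω.inv k, smul_inv_smul]

theorem neg_mem_centers {v : V} (hv : v ∈ centers H ω) : -v ∈ centers H ω := by
  obtain ⟨h0, h, hh⟩ := hv
  exact ⟨neg_ne_zero.2 h0, h, fun w => by rw [hh]; simp⟩

omit [Module (ZMod 3) V] in
theorem eq_one_or_eq_neg_one {c : ZMod 3} (hc : c ≠ 0) : c = 1 ∨ c = -1 := by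
  revert c
  decide

theorem add_mem_centers (hω : IsSymplecticAction H ω) {v w : V} (hv : v ∈ centers H ω)
    (hw : w ∈ centers H ω) (hvw : ω v w ≠ 0) : v + w ∈ centers H ω := by
  rcases eq_one_or_eq_neg_one hvw with h1 | h1
  · obtain ⟨-, h, hh⟩ := hv
    have := hω.smul_mem_centers h hw
    rwa [hh, h1, one_smul, add_comm] at this
  · obtain ⟨-, h, hh⟩ := hw
    have := hω.smul_mem_centers h hv
    rwa [hh, hω.skew, h1, neg_neg, one_smul] at this

theorem sub_mem_centers (hω : IsSymplecticAction H ω) {v w : V} (hv : v ∈ centers H ω)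
    (hw : w ∈ centers H ω) (hvw : ω v w ≠ 0) : v - w ∈ centers H ω := by
  rw [sub_eq_add_neg]
  exact hω.add_mem_centers hv (neg_mem_centers hw) (by simpa using hvw)

theorem mem_centers_of_forall_perp (hω : IsSymplecticAction H ω) {h : H} {u : V} (h1 : h ≠ 1)
    (hh : ∀ w, ω u w = 0 → h • w = w) (hu : u ≠ 0) : u ∈ centers H ω := by
  obtain ⟨y, hy⟩ := hω.exists_ne_zero hu
  have hhu : h • u = u := hh u (hω.alt u)
  have hdec (w : V) : ∃ (c : ZMod 3) (p : V), ω u p = 0 ∧ w = c • y + p :=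
    ⟨ω u w / ω u y, w - (ω u w / ω u y) • y, by simp [hy], by abel⟩
  have hperp (p : V) (hp : ω u p = 0) : ω (h • y - y) p = 0 := by
    have := hω.inv h y p
    rw [hh p hp] at this
    rw [map_sub, LinearMap.sub_apply, this, sub_self]
  obtain ⟨e, he⟩ : ∃ e : ZMod 3, h • y - y = e • u := by
    set e := ω (h • y - y) y / ω u y with hedef
    refine ⟨e, sub_eq_zero.1 (hω.nondeg _ fun w => ?_)⟩
    obtain ⟨c, p, hp, rfl⟩ := hdec w
    have h2 : ω (h • y - y - e • u) p = 0 := by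
      rw [map_sub, LinearMap.sub_apply, hperp p hp, map_smul, LinearMap.smul_apply, hp]
      simp
    have h3 : ω (h • y - y - e • u) y = 0 := by
      rw [map_sub, LinearMap.sub_apply, map_smul, LinearMap.smul_apply, hedef, smul_eq_mul,
        div_mul_cancel₀ _ hy, sub_self]
    rw [map_add, map_smul, h2, h3]
    simp
  have he0 : e ≠ 0 := by
    rintro rfl
    refine h1 (hω.faithful h fun w => ?_)
    obtain ⟨c, p, hp, rfl⟩ := hdec w
    rw [smul_add, hh p hp, smul_zmod_smul, sub_eq_zero.1 (he.trans (zero_smul _ _))]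
  have hform (w : V) : h • w = w + (e / ω u y * ω u w) • u := by
    obtain ⟨c, p, hp, rfl⟩ := hdec w
    rw [smul_add, hh p hp, smul_zmod_smul, sub_eq_iff_eq_add.1 he, map_add, map_smul, hp, add_zero,
      smul_add, smul_smul, smul_eq_mul, show e / ω u y * (c * ω u y) = c * e by field_simp]
    abel
  refine ⟨hu, ?_⟩
  rcases eq_one_or_eq_neg_one (div_ne_zero he0 hy) with h2 | h2
  · exact ⟨h, fun w => by rw [hform, h2, one_mul]⟩
  · refine ⟨h⁻¹, fun w => ?_⟩
    rw [inv_smul_eq_iff, smul_add, smul_zmod_smul, hhu, hform, h2]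
    simp

section Related

variable (hω : IsSymplecticAction H ω)
  (hT : ∀ z : V, z ≠ 0 → ∃ t ∈ centers H ω, ω t z ≠ 0)

include hω

theorem add_mem_centers_of_eq {a b t : V} (ha : a ∈ centers H ω) (hb : b ∈ centers H ω)
    (ht : t ∈ centers H ω) (h0 : ω t a ≠ 0) (h : ω t b = ω t a) : a + b ∈ centers H ω := by
  by_cases hab : ω a b = 0
  swap
  · exact hω.add_mem_centers ha hb hab
  have h1 := hω.add_mem_centers ht ha h0
  have h2 := hω.add_mem_centers h1 hb (by
    rw [map_add, LinearMap.add_apply, hab, add_zero, h]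
    exact h0)
  have h3 := hω.sub_mem_centers h2 ht (by
    simp only [map_add, LinearMap.add_apply, hω.alt, hω.skew _ t, h]
    revert h0
    generalize ω t a = c
    revert c
    decide)
  rwa [show t + a + b - t = a + b by abel] at h3

theorem add_mem_centers_of_eq_neg {a b s t : V} (ha : a ∈ centers H ω) (hb : b ∈ centers H ω)
    (hs : s ∈ centers H ω) (ht : t ∈ centers H ω) (hab : ω a b = 0) (hta : ω t a ≠ 0)
    (htb : ω t b = - ω t a) (hsa : ω s a ≠ 0) (hsb : ω s b = 0) : a + b ∈ centers H ω := by
  have key (t : V) (ht : t ∈ centers H ω) (hta : ω t a ≠ 0) (htb : ω t b = - ω t a)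
      (hts : ω t s ≠ 0) : a + b ∈ centers H ω := by
    have h : ω s a = ω t a ∨ ω s a = - ω t a := by
      revert hta hsa
      generalize ω s a = c
      generalize ω t a = d
      revert c d
      decide
    have h2 : ω t a + ω t a = - ω t a := by
      generalize ω t a = c
      revert c
      decide
    rcases h with h | h
    · refine hω.add_mem_centers_of_eq ha hb (hω.add_mem_centers ht hs hts) ?_ ?_
      · simp only [map_add, LinearMap.add_apply, h, h2]
        exact neg_ne_zero.2 hta
      · simp only [map_add, LinearMap.add_apply, h, h2, hsb, add_zero, htb]
    · refine hω.add_mem_centers_of_eq ha hb (hω.sub_mem_centers ht hs hts) ?_ ?_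
      · simp only [map_sub, LinearMap.sub_apply, h, sub_neg_eq_add, h2]
        exact neg_ne_zero.2 hta
      · simp only [map_sub, LinearMap.sub_apply, h, sub_neg_eq_add, h2, hsb, sub_zero, htb]
  by_cases hts : ω t s = 0
  swap
  · exact key t ht hta htb hts
  refine key (t + a) (hω.add_mem_centers ht ha hta) ?_ ?_ ?_
  · simpa [hω.alt] using hta
  · simp [hω.alt, htb, hab]
  · rw [map_add, LinearMap.add_apply, hts, zero_add, hω.skew]
    exact neg_ne_zero.2 hsa

omit hω in
/-- Two centers are related if some center is orthogonal to neither of them. -/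
def Related (H : Type*) [Group H] [DistribMulAction H V] (ω : LinearMap.BilinForm (ZMod 3) V)
    (a b : V) : Prop :=
  a ∈ centers H ω ∧ b ∈ centers H ω ∧ ∃ t ∈ centers H ω, ω t a ≠ 0 ∧ ω t b ≠ 0

omit hω in
theorem Related.symm {a b : V} (h : Related H ω a b) : Related H ω b a :=
  ⟨h.2.1, h.1, let ⟨t, ht, h1, h2⟩ := h.2.2; ⟨t, ht, h2, h1⟩⟩

theorem related_of_path {a p q b : V} (ha : a ∈ centers H ω) (hp : p ∈ centers H ω)
    (hq : q ∈ centers H ω) (hb : b ∈ centers H ω) (hpa : ω p a ≠ 0) (hpq : ω p q ≠ 0)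
    (hqb : ω q b ≠ 0) : Related H ω a b := by
  refine ⟨ha, hb, ?_⟩
  by_cases h1 : ω q a = 0
  swap
  · exact ⟨q, hq, h1, hqb⟩
  by_cases h2 : ω p b = 0
  swap
  · exact ⟨p, hp, hpa, h2⟩
  exact ⟨p + q, hω.add_mem_centers hp hq hpq, by simpa [h1] using hpa, by simpa [h2] using hqb⟩

theorem ne_zero_symm {a b : V} (h : ω a b ≠ 0) : ω b a ≠ 0 := by
  rwa [hω.skew, neg_ne_zero]

theorem related_trans {a b c : V} (hab : Related H ω a b) (hbc : Related H ω b c) :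
    Related H ω a c := by
  obtain ⟨ha, hb, t, ht, hta, htb⟩ := hab
  obtain ⟨-, hc, s, hs, hsb, hsc⟩ := hbc
  obtain ⟨-, -, r, hr, hra, hrs⟩ := hω.related_of_path ha ht hb hs hta htb (hω.ne_zero_symm hsb)
  exact hω.related_of_path ha hr hs hc hra hrs hsc

theorem related_of_ne {a b : V} (ha : a ∈ centers H ω) (hb : b ∈ centers H ω) (h : ω a b ≠ 0) :
    Related H ω a b :=
  ⟨ha, hb, a + b, hω.add_mem_centers ha hb h, by
    simpa [hω.alt] using hω.ne_zero_symm h, by simpa [hω.alt] using h⟩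

theorem smul_related {a b : V} (h : Related H ω a b) (k : H) : Related H ω (k • a) (k • b) := by
  obtain ⟨ha, hb, t, ht, hta, htb⟩ := h
  exact ⟨hω.smul_mem_centers k ha, hω.smul_mem_centers k hb, k • t, hω.smul_mem_centers k ht,
    by rwa [hω.inv], by rwa [hω.inv]⟩

include hT

theorem add_mem_centers_of_related {a b : V} (h : Related H ω a b) (hab0 : a + b ≠ 0) :
    a + b ∈ centers H ω := by
  obtain ⟨ha, hb, t, ht, hta, htb⟩ := h
  by_cases hab : ω a b = 0
  swap
  · exact hω.add_mem_centers ha hb hab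
  by_cases heq : ω t b = ω t a
  · exact hω.add_mem_centers_of_eq ha hb ht hta heq
  have hneg : ω t b = - ω t a := by
    revert hta htb heq
    generalize ω t a = c
    generalize ω t b = d
    revert c d
    decide
  obtain ⟨s, hs, hs0⟩ := hT _ hab0
  rw [map_add] at hs0
  have hcases : (ω s a ≠ 0 ∧ ω s b = ω s a) ∨ (ω s a ≠ 0 ∧ ω s b = 0) ∨
      (ω s b ≠ 0 ∧ ω s a = 0) := by
    revert hs0
    generalize ω s a = c
    generalize ω s b = d
    revert c d
    decide
  rcases hcases with ⟨h1, h2⟩ | ⟨h1, h2⟩ | ⟨h1, h2⟩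
  · exact hω.add_mem_centers_of_eq ha hb hs h1 h2
  · exact hω.add_mem_centers_of_eq_neg ha hb hs ht hab hta hneg h1 h2
  · rw [add_comm]
    exact hω.add_mem_centers_of_eq_neg hb ha hs ht (by rw [hω.skew, hab, neg_zero]) htb
      (by rw [hneg, neg_neg]) h1 h2

theorem related_add {a b c : V} (hb : Related H ω a b) (hc : Related H ω a c) (h0 : b + c ≠ 0) :
    Related H ω a (b + c) := by
  have hbc := hω.add_mem_centers_of_related hT (hω.related_trans hb.symm hc) h0
  obtain ⟨t, ht, ht0⟩ := hT _ h0
  by_cases htb : ω t b = 0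
  · refine hω.related_trans hc ⟨hc.2.1, hbc, t, ht, ?_, ht0⟩
    rwa [map_add, htb, zero_add] at ht0
  · exact hω.related_trans hb ⟨hb.2.1, hbc, t, ht, htb, ht0⟩

omit hT in
theorem exists_pow_smul_ne_zero {g : H} (hg : g ≠ 1) (hg7 : g ^ 7 = 1) {a : V} (ha : a ≠ 0) :
    ∃ k ∈ Subgroup.zpowers g, ω a (k • a) ≠ 0 := by
  by_contra! hcon
  let A : AddSubgroup V := AddSubgroup.closure {v | ∃ k ∈ Subgroup.zpowers g, v = k • a}
  have haA : a ∈ A := AddSubgroup.subset_closure ⟨1, one_mem _, (one_smul _ _).symm⟩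
  have hgA : ∀ b ∈ A, g • b ∈ A := by
    intro b hb
    induction hb using AddSubgroup.closure_induction with
    | mem x hx =>
      obtain ⟨k, hk, rfl⟩ := hx
      exact AddSubgroup.subset_closure
        ⟨g * k, mul_mem (Subgroup.mem_zpowers g) hk, by rw [mul_smul]⟩
    | zero => simp
    | add x y _ _ h1 h2 => rw [smul_add]; exact add_mem h1 h2
    | neg x _ h1 => rw [smul_neg]; exact neg_mem h1
  have hle : A ≤ perp ω a := by
    rw [AddSubgroup.closure_le]
    rintro _ ⟨k, hk, rfl⟩
    exact hcon k hk
  rcases hω.eq_bot_or_eq_top_of_pow_seven hg hg7 hgA with h | h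
  · rw [h, AddSubgroup.mem_bot] at haA
    exact ha haA
  · rw [h, top_le_iff] at hle
    exact ha (hω.nondeg a fun w => (mem_perp (ω := ω)).1 (hle ▸ AddSubgroup.mem_top w))

theorem mem_centers_of_ne_zero {g : H} (hg : g ≠ 1) (hg7 : g ^ 7 = 1) {a : V}
    (ha : a ∈ centers H ω) {v : V} (hv : v ≠ 0) : v ∈ centers H ω := by
  obtain ⟨k, hk, hka⟩ := hω.exists_pow_smul_ne_zero hg hg7 ha.1
  have hrel : Related H ω a (k • a) := hω.related_of_ne ha (hω.smul_mem_centers k ha) hka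
  let U : AddSubgroup V :=
    { carrier := {b | b = 0 ∨ Related H ω a b}
      add_mem' := by
        rintro b c (rfl | hb) (rfl | hc)
        · exact Or.inl (add_zero 0)
        · rw [zero_add]
          exact Or.inr hc
        · rw [add_zero]
          exact Or.inr hb
        · by_cases h0 : b + c = 0
          · exact Or.inl h0
          · exact Or.inr (hω.related_add hT hb hc h0)
      zero_mem' := Or.inl rfl
      neg_mem' := by
        rintro b (rfl | ⟨ha, hb, t, ht, hta, htb⟩)
        · exact Or.inl neg_zero
        · exact Or.inr ⟨ha, neg_mem_centers hb, t, ht, hta, by simpa using htb⟩ }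
  have hkU : ∀ b ∈ U, k • b ∈ U := by
    rintro b (rfl | hb)
    · exact Or.inl (smul_zero k)
    · exact Or.inr (hω.related_trans hrel (hω.smul_related hb k))
  have hk1 : k ≠ 1 := by
    rintro rfl
    rw [one_smul] at hka
    exact hka (hω.alt a)
  have hk7 : k ^ 7 = 1 := by
    obtain ⟨n, rfl⟩ := hk
    change (g ^ n) ^ 7 = 1
    rw [← zpow_natCast, zpow_comm, zpow_natCast, hg7, _root_.one_zpow]
  have haU : a ∈ U := Or.inr (hω.related_trans hrel hrel.symm)
  rcases hω.eq_bot_or_eq_top_of_pow_seven hk1 hk7 hkU with h | h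
  · rw [h, AddSubgroup.mem_bot] at haU
    exact absurd haU ha.1
  · have hvU : v ∈ U := h ▸ AddSubgroup.mem_top v
    exact (hvU.resolve_left hv).2.1

end Related

/-- If a linear group of order divisible by `3 * 5 * 7 * 13` preserves a symplectic form on
`F_3^6`, then it contains all the transvections. -/
theorem exists_smul_eq_add (hω : IsSymplecticAction H ω) [Finite H] (h3 : 3 ∣ Nat.card H)
    (h5 : 5 ∣ Nat.card H) (h7 : 7 ∣ Nat.card H) (h13 : 13 ∣ Nat.card H)
    (h25 : ¬ 25 ∣ Nat.card H) (v : V) : ∃ h : H, ∀ w, h • w = w + ω v w • v := by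
  have : Fact (Nat.Prime 7) := ⟨by norm_num⟩
  by_cases hv : v = 0
  · exact ⟨1, fun w => by simp [hv]⟩
  obtain ⟨h, u, h1, hu, hh⟩ := hω.exists_transvection h3 h5 h7 h13 h25
  have huT := hω.mem_centers_of_forall_perp h1 hh hu
  obtain ⟨g, hg⟩ := exists_prime_orderOf_dvd_card' 7 h7
  have hg1 : g ≠ 1 := by
    rintro rfl
    rw [orderOf_one] at hg
    omega
  have hg7 : g ^ 7 = 1 := hg ▸ pow_orderOf_eq_one g
  refine (hω.mem_centers_of_ne_zero (fun z hz => ?_) hg1 hg7 huT hv).2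
  by_contra! hcon
  let A : AddSubgroup V :=
    { carrier := {z | ∀ t ∈ centers H ω, ω t z = 0}
      add_mem' := fun ha hb t ht => by rw [map_add, ha t ht, hb t ht, add_zero]
      zero_mem' := fun t _ => map_zero _
      neg_mem' := fun ha t ht => by rw [map_neg, ha t ht, neg_zero] }
  have hgA : ∀ a ∈ A, g • a ∈ A := fun a ha t ht => by
    rw [← hω.inv g⁻¹, inv_smul_smul]
    exact ha _ (hω.smul_mem_centers _ ht)
  have hzA : z ∈ A := hcon
  rcases hω.eq_bot_or_eq_top_of_pow_seven hg1 hg7 hgA with h | h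
  · rw [h, AddSubgroup.mem_bot] at hzA
    exact hz hzA
  · refine hu (hω.nondeg u fun w => ?_)
    have hwA : w ∈ A := h ▸ AddSubgroup.mem_top w
    exact hwA u huT

section Generation

variable (hω : IsSymplecticAction H ω) {K : Subgroup H}
  (hK : ∀ v : V, ∃ k ∈ K, ∀ w, k • w = w + ω v w • v)

include hω

theorem sub_apply_eq_zero {m : H} {f : V} (hf : m • f = f) (y : V) : ω (m • y - y) f = 0 := by
  have h := hω.inv m y f
  rw [hf] at h
  rw [map_sub, LinearMap.sub_apply, h, sub_self]

include hK

theorem exists_mem_of_apply_ne_zero {m : H} {x : V} (hx : ω (m • x) x ≠ 0) :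
    ∃ k ∈ K, (k⁻¹ * m) • x = x ∧ ∀ f : V, m • f = f → (k⁻¹ * m) • f = f := by
  obtain ⟨k, hk, hkw⟩ := hK (m • x - x)
  have hkf (f : V) (hf : m • f = f) : k • f = f := by
    rw [hkw, hω.sub_apply_eq_zero hf, zero_smul, add_zero]
  have hval : ω (m • x - x) x = ω (m • x) x := by
    rw [map_sub, LinearMap.sub_apply, hω.alt, sub_zero]
  rcases eq_one_or_eq_neg_one hx with h | h
  · refine ⟨k, hk, ?_, fun f hf => ?_⟩
    · rw [mul_smul, inv_smul_eq_iff, hkw, hval, h, one_smul]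
      abel
    · rw [mul_smul, hf, inv_smul_eq_iff, hkf f hf]
  · refine ⟨k⁻¹, inv_mem hk, ?_, fun f hf => ?_⟩
    · rw [inv_inv, mul_smul, show m • x = x + (m • x - x) by abel, smul_add, hkw, hkw, hval, h,
        hω.alt, neg_one_smul, zero_smul]
      abel
    · rw [inv_inv, mul_smul, hf, hkf f hf]

theorem exists_fixed_lt {m : H} {x : V} (hx : m • x ≠ x) :
    ∃ k ∈ K, fixed V m < fixed V (k * m) := by
  suffices h : ∃ k ∈ K, (k * m) • x = x ∧ ∀ f : V, m • f = f → (k * m) • f = f by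
    obtain ⟨k, hk, h1, h2⟩ := h
    exact ⟨k, hk, lt_of_le_of_ne h2 fun h => hx (mem_fixed.1 (h ▸ mem_fixed.2 h1))⟩
  have hne (h : ∀ y, ω y (m • x) = ω y x) : False := by
    refine hx (sub_eq_zero.1 (hω.nondeg _ fun y => ?_))
    rw [hω.skew, map_sub, h, sub_self, neg_zero]
  obtain ⟨a, ha⟩ : ∃ a, ω (m • a - a) x ≠ 0 := by
    by_contra! hcon
    refine hne fun y => ?_
    obtain ⟨z, rfl⟩ : ∃ z, m • z = y := ⟨m⁻¹ • y, smul_inv_smul _ _⟩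
    have := hcon z
    rw [map_sub, LinearMap.sub_apply, sub_eq_zero] at this
    rw [this, hω.inv]
  obtain ⟨b, hb⟩ : ∃ b, ω (m • b - b) (m • x) ≠ 0 := by
    by_contra! hcon
    refine hne fun y => ?_
    have := hcon y
    rw [map_sub, LinearMap.sub_apply, sub_eq_zero, hω.inv] at this
    exact this.symm
  obtain ⟨y, hy, hy'⟩ : ∃ y, ω (m • y - y) x ≠ 0 ∧ ω (m • y - y) (m • x) ≠ 0 := by
    by_cases h1 : ω (m • a - a) (m • x) = 0
    swap
    · exact ⟨a, ha, h1⟩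
    by_cases h2 : ω (m • b - b) x = 0
    swap
    · exact ⟨b, h2, hb⟩
    refine ⟨a + b, ?_, ?_⟩ <;>
      rw [smul_add, add_sub_add_comm, map_add, LinearMap.add_apply]
    · rwa [h2, add_zero]
    · rwa [h1, zero_add]
  by_cases h0 : ω (m • x) x = 0
  swap
  · obtain ⟨k, hk, h⟩ := hω.exists_mem_of_apply_ne_zero hK h0
    exact ⟨k⁻¹, inv_mem hk, h⟩
  obtain ⟨l, hl, hlw⟩ := hK (m • y - y)
  have h1 : ω ((l * m) • x) x ≠ 0 := by
    rw [mul_smul, hlw, map_add, LinearMap.add_apply, h0, zero_add, map_smul, LinearMap.smul_apply]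
    exact mul_ne_zero hy' hy
  obtain ⟨k, hk, h2, h3⟩ := hω.exists_mem_of_apply_ne_zero hK h1
  refine ⟨k⁻¹ * l, mul_mem (inv_mem hk) hl, ?_, fun f hf => ?_⟩
  · rwa [mul_assoc]
  · rw [mul_assoc]
    refine h3 f ?_
    rw [mul_smul, hf, hlw, hω.sub_apply_eq_zero hf, zero_smul, add_zero]

/-- A group of symplectic isometries that contains all the transvections is the whole symplectic
group. -/
theorem mem_of_transvections (m : H) : m ∈ K := by
  have : Finite V := hω.finite
  by_contra hm
  have hex : ∃ m : H, m ∉ K := ⟨m, hm⟩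
  obtain ⟨m, hm, hmax⟩ := WellFounded.has_min
    (InvImage.wf (fun m : H => fixed V m) (wellFounded_gt (α := AddSubgroup V))) {m | m ∉ K} hex
  obtain ⟨x, hx⟩ : ∃ x : V, m • x ≠ x := by
    by_contra! hcon
    exact hm (hω.faithful m hcon ▸ one_mem K)
  obtain ⟨k, hk, hlt⟩ := hω.exists_fixed_lt hK hx
  exact hmax (k * m) (fun h => hm ((K.mul_mem_cancel_left hk).1 h)) hlt

end Generation

end IsSymplecticAction

namespace Matrix

variable {n R : Type*} [Fintype n] [DecidableEq n] [CommRing R]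

/-- The invertible matrices that preserve the bilinear form with matrix `J`. -/
def isometryGroup (J : Matrix n n R) : Subgroup (GL n R) where
  carrier := {M | (M : Matrix n n R)ᵀ * J * M = J}
  mul_mem' {a b} ha hb := by
    simp only [Set.mem_ofPred_eq, GeneralLinearGroup.coe_mul, transpose_mul] at *
    calc _ = (b : Matrix n n R)ᵀ * ((a : Matrix n n R)ᵀ * J * a) * b := by
          simp only [Matrix.mul_assoc]
      _ = J := by rw [ha, hb]
  one_mem' := by simp
  inv_mem' {a} ha := by
    simp only [Set.mem_ofPred_eq] at *
    calc _ = ((a⁻¹ : GL n R) : Matrix n n R)ᵀ * ((a : Matrix n n R)ᵀ * J * a) *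
          ((a⁻¹ : GL n R) : Matrix n n R) := by rw [ha]
      _ = ((a * a⁻¹ : GL n R) : Matrix n n R)ᵀ * J * ((a * a⁻¹ : GL n R) : Matrix n n R) := by
          simp only [GeneralLinearGroup.coe_mul, transpose_mul, Matrix.mul_assoc]
      _ = J := by simp

theorem mem_isometryGroup {J : Matrix n n R} {M : GL n R} :
    M ∈ isometryGroup J ↔ (M : Matrix n n R)ᵀ * J * M = J := Iff.rfl

theorem similitude_mul {J : Matrix n n R} {M N : GL n R} {c d : R}
    (hM : (M : Matrix n n R)ᵀ * J * M = c • J) (hN : (N : Matrix n n R)ᵀ * J * N = d • J) :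
    ((M * N : GL n R) : Matrix n n R)ᵀ * J * (M * N : GL n R) = (c * d) • J := by
  simp only [GeneralLinearGroup.coe_mul, transpose_mul]
  calc _ = (N : Matrix n n R)ᵀ * ((M : Matrix n n R)ᵀ * J * M) * N := by
        simp only [Matrix.mul_assoc]
    _ = _ := by rw [hM, Matrix.mul_smul, Matrix.smul_mul, hN, smul_smul]

theorem dotProduct_mulVec_of_mem_isometryGroup {J : Matrix n n R} {M : GL n R}
    (hM : M ∈ isometryGroup J) (v w : n → R) :
    ((M : Matrix n n R) *ᵥ v) ⬝ᵥ J *ᵥ ((M : Matrix n n R) *ᵥ w) = v ⬝ᵥ J *ᵥ w := by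
  rw [← vecMul_transpose, ← dotProduct_mulVec, mulVec_mulVec, mulVec_mulVec,
    mem_isometryGroup.1 hM]

/-- The action of a group of invertible matrices on column vectors. -/
abbrev mulVecAction (S : Subgroup (GL n R)) : DistribMulAction S (n → R) where
  smul M v := ((M : GL n R) : Matrix n n R) *ᵥ v
  one_smul v := one_mulVec v
  mul_smul M N v := (mulVec_mulVec v ((M : GL n R) : Matrix n n R) ((N : GL n R) : Matrix n n R)).symm
  smul_zero _ := mulVec_zero _
  smul_add _ v w := mulVec_add _ v w

end Matrix

theorem not_twenty_five_dvd_card_GL : ¬ 25 ∣ Nat.card (GL (Fin 3 ⊕ Fin 3) (ZMod 3)) := by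
  have e : GL (Fin 3 ⊕ Fin 3) (ZMod 3) ≃* GL (Fin 6) (ZMod 3) :=
    Units.mapEquiv (Matrix.reindexAlgEquiv (ZMod 3) (ZMod 3) finSumFinEquiv).toMulEquiv
  have : Fact (Nat.Prime 3) := ⟨Nat.prime_three⟩
  rw [Nat.card_congr e.toEquiv, Matrix.card_GL_field, ZMod.card]
  simp only [Fin.prod_univ_succ]
  decide

theorem isSymplecticAction_isometryGroup {J : Matrix (Fin 3 ⊕ Fin 3) (Fin 3 ⊕ Fin 3) (ZMod 3)}
    (hJ : J = fromBlocks 0 1 (-1) 0) :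
    let _ := mulVecAction (isometryGroup J)
    IsSymplecticAction (isometryGroup J) (Matrix.toBilin' J) := by
  intro _
  refine ⟨by simp, fun v => ?_, fun v h => ?_, fun h v w => ?_, fun h hh => ?_⟩
  · simp [hJ, Matrix.toBilin'_apply', Matrix.mulVec, dotProduct, Fin.sum_univ_three, Matrix.one_apply]
    ring
  · simp only [Matrix.toBilin'_apply', dotProduct_mulVec] at h
    have h1 := dotProduct_eq_zero _ h
    have h2 := congrArg (fun x => x ᵥ* J) h1
    simp only [vecMul_vecMul, hJ, fromBlocks_multiply, zero_vecMul] at h2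
    have h3 : fromBlocks (-1) 0 0 (-1) =
        (-1 : Matrix (Fin 3 ⊕ Fin 3) (Fin 3 ⊕ Fin 3) (ZMod 3)) := by
      rw [← fromBlocks_one, fromBlocks_neg, neg_zero]
    simpa [h3, vecMul_neg] using h2
  · rw [Matrix.toBilin'_apply', Matrix.toBilin'_apply']
    exact dotProduct_mulVec_of_mem_isometryGroup h.2 v w
  · refine Subtype.ext (Units.ext (ext_of_mulVec_single fun i => ?_))
    exact (hh (Pi.single i 1)).trans (one_mulVec _).symm

/-- Let `J` be the standard symplectic matrix on `F_3^6 = F_3^3 ⊕ F_3^3`. If `G` is a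
subgroup of `GSp_6(F_3) = {M ∈ GL_6(F_3) : MᵀJM = cJ for some c ∈ F_3ˣ}` whose order is
divisible by `2³·3²·5·7·13`, then `G = Sp_6(F_3)` or `G = GSp_6(F_3)`. -/
theorem stmt_13 (J : Matrix (Fin 3 ⊕ Fin 3) (Fin 3 ⊕ Fin 3) (ZMod 3))
    (hJ : J = Matrix.fromBlocks 0 1 (-1) 0)
    (G : Subgroup (GL (Fin 3 ⊕ Fin 3) (ZMod 3)))
    (hG : ∀ M ∈ G, ∃ c : (ZMod 3)ˣ,
      (M : Matrix (Fin 3 ⊕ Fin 3) (Fin 3 ⊕ Fin 3) (ZMod 3))ᵀ * J * M = (c : ZMod 3) • J)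
    (hord : 2 ^ 3 * 3 ^ 2 * 5 * 7 * 13 ∣ Nat.card G) :
    (∀ M : GL (Fin 3 ⊕ Fin 3) (ZMod 3), M ∈ G ↔
      (M : Matrix (Fin 3 ⊕ Fin 3) (Fin 3 ⊕ Fin 3) (ZMod 3))ᵀ * J * M = J) ∨
    (∀ M : GL (Fin 3 ⊕ Fin 3) (ZMod 3), M ∈ G ↔ ∃ c : (ZMod 3)ˣ,
      (M : Matrix (Fin 3 ⊕ Fin 3) (Fin 3 ⊕ Fin 3) (ZMod 3))ᵀ * J * M = (c : ZMod 3) • J) := by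
  have hunit (c : (ZMod 3)ˣ) : (c : ZMod 3) * c = 1 := by
    revert c
    decide
  have hmul : ∀ c d : (ZMod 3)ˣ, c ≠ 1 → d ≠ 1 → (c : ZMod 3) * d = 1 := by decide
  have hdvd (p : ℕ) [Fact p.Prime] (hodd : Odd p) (hp : p ∣ Nat.card G) :
      p ∣ Nat.card (G.subgroupOf (isometryGroup J)) := by
    obtain ⟨g, hg⟩ := exists_prime_orderOf_dvd_card' p hp
    obtain ⟨k, hk⟩ := hodd
    obtain ⟨c, hc⟩ := hG g g.2
    have h2 : (g : GL (Fin 3 ⊕ Fin 3) (ZMod 3)) * g ∈ isometryGroup J := by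
      rw [mem_isometryGroup, similitude_mul hc hc, hunit, one_smul]
    have hg1 : (g : GL (Fin 3 ⊕ Fin 3) (ZMod 3)) ∈ isometryGroup J := by
      have h3 : g ^ p = 1 := hg ▸ pow_orderOf_eq_one g
      have h4 : (g * g) ^ (k + 1) = g := by
        rw [← pow_two, ← pow_mul, show 2 * (k + 1) = p + 1 by omega, pow_succ, h3, one_mul]
      have h5 := pow_mem h2 (k + 1)
      rwa [show ((g : GL (Fin 3 ⊕ Fin 3) (ZMod 3)) * g) ^ (k + 1) = g from
        congrArg Subtype.val h4] at h5
    have h6 := orderOf_dvd_natCard (⟨⟨g, hg1⟩, g.2⟩ : G.subgroupOf (isometryGroup J))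
    rwa [← Subgroup.orderOf_coe, ← Subgroup.orderOf_coe, Subgroup.orderOf_coe g, hg] at h6
  have h25 : ¬ 25 ∣ Nat.card (G.subgroupOf (isometryGroup J)) := fun h =>
    not_twenty_five_dvd_card_GL ((h.trans (Subgroup.card_subgroup_dvd_card _)).trans
      (Subgroup.card_subgroup_dvd_card _))
  have hle (M : GL (Fin 3 ⊕ Fin 3) (ZMod 3))
      (hM : (M : Matrix (Fin 3 ⊕ Fin 3) (Fin 3 ⊕ Fin 3) (ZMod 3))ᵀ * J * M = J) : M ∈ G := by
    let _ := mulVecAction (isometryGroup J)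
    have hω := isSymplecticAction_isometryGroup hJ
    have : Fact (Nat.Prime 3) := ⟨by norm_num⟩
    have : Fact (Nat.Prime 5) := ⟨by norm_num⟩
    have : Fact (Nat.Prime 7) := ⟨by norm_num⟩
    have : Fact (Nat.Prime 13) := ⟨by norm_num⟩
    have h := hω.mem_of_transvections (K := G.subgroupOf (isometryGroup J)) (fun v => ?_) ⟨M, hM⟩
    · exact h
    obtain ⟨k, hk⟩ := (hω.restrict (G.subgroupOf (isometryGroup J))).exists_smul_eq_add
      (hdvd 3 (by decide) ((by norm_num : 3 ∣ _).trans hord))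
      (hdvd 5 (by decide) ((by norm_num : 5 ∣ _).trans hord))
      (hdvd 7 (by decide) ((by norm_num : 7 ∣ _).trans hord))
      (hdvd 13 (by decide) ((by norm_num : 13 ∣ _).trans hord)) h25 v
    exact ⟨k, k.2, hk⟩
  by_cases hS : ∀ M ∈ G, (M : Matrix (Fin 3 ⊕ Fin 3) (Fin 3 ⊕ Fin 3) (ZMod 3))ᵀ * J * M = J
  · exact Or.inl fun M => ⟨hS M, hle M⟩
  refine Or.inr fun M => ⟨hG M, ?_⟩
  rintro ⟨c, hc⟩
  push Not at hS
  obtain ⟨N, hN, hNJ⟩ := hS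
  obtain ⟨d, hd⟩ := hG N hN
  have hd1 : d ≠ 1 := by
    rintro rfl
    exact hNJ (by rw [hd, Units.val_one, one_smul])
  by_cases hc1 : c = 1
  · exact hle M (by rw [hc, hc1, Units.val_one, one_smul])
  exact (G.mul_mem_cancel_left hN).1
    (hle _ (by rw [similitude_mul hd hc, hmul d c hd1 hc1, one_smul]))
end
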